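/- Let A be an n-dimensional anticommutative algebra (a·a = 0 for all a ∈ A). (1) If n = 2, then lev(A) ≤ 1. (2) If n = 3, then lev(A) = 2 iff A is represented by T_0^{2,(α,β)} for some (α,β) ∈ k²∖{(0,0)}. (3) If n = 4, then lev(A) = 2 iff A is represented by T_0^{2,(α,β)} for some (α,β) ∈ k²∖{(0,0)} or by T_0^3. (4) If n ≥ 5, then lev(A) = 2 iff A is represented by T_0^{2,(α,β)} for some (α,β) ∈ k²∖{(0,0)}, by T_0^{2,2}, or by η_2 ⊕ k^{n−5}. In particular, every anticommutative algebra of level 2 satisfies the Jacobi identity, i.e., is a Lie algebra. -/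

import Mathlib

open scoped BigOperators

noncomputable section

/-- The space of `n`-dimensional (nonassociative) algebra structures on `kⁿ`:
bilinear maps `kⁿ × kⁿ → kⁿ`. -/
abbrev AlgStr (k : Type*) [Field k] (n : ℕ) : Type _ :=
  (Fin n → k) →ₗ[k] (Fin n → k) →ₗ[k] (Fin n → k)

variable {k : Type*} [Field k]

/-- The algebra structure with prescribed structure constants `c`:
`μ(x, y) m = ∑ i, ∑ j, x i * y j * c i j m`. -/
def ofConst {n : ℕ} (c : Fin n → Fin n → Fin n → k) : AlgStr k n :=
  ∑ i, ∑ j,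
    ((LinearMap.mul k k).compl₁₂ (LinearMap.proj i) (LinearMap.proj j)).compr₂
      (LinearMap.toSpanSingleton k (Fin n → k) (c i j))

/-- The structure constants of an algebra structure in the standard basis. -/
def structConst {n : ℕ} (μ : AlgStr k n) : Fin n × Fin n × Fin n → k :=
  fun t => μ (Pi.single t.1 1) (Pi.single t.2.1 1) t.2.2

/-- A subset of `AlgStr k n` is Zariski closed if it is the common zero locus of a
family of polynomials in the structure constants. -/
def IsZariskiClosed {n : ℕ} (S : Set (AlgStr k n)) : Prop :=
  ∃ P : Set (MvPolynomial (Fin n × Fin n × Fin n) k),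
    ∀ μ : AlgStr k n, μ ∈ S ↔ ∀ p ∈ P, MvPolynomial.eval (structConst μ) p = 0

/-- The action of `GL(V)` on algebra structures: `(g • μ)(x,y) = g (μ (g⁻¹ x) (g⁻¹ y))`. -/
def transport {n : ℕ} (g : (Fin n → k) ≃ₗ[k] (Fin n → k)) (μ : AlgStr k n) :
    AlgStr k n :=
  ((μ.comp g.symm.toLinearMap).compl₂ g.symm.toLinearMap).compr₂ g.toLinearMap

/-- The `GL(V)`-orbit of an algebra structure; two structures represent isomorphic
algebras iff they lie in the same orbit. -/
def orbit {n : ℕ} (μ : AlgStr k n) : Set (AlgStr k n) :=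
  {χ | ∃ g : (Fin n → k) ≃ₗ[k] (Fin n → k), transport g μ = χ}

/-- The Zariski closure of a set of algebra structures. -/
def zclosure {n : ℕ} (S : Set (AlgStr k n)) : Set (AlgStr k n) :=
  {χ | ∀ T : Set (AlgStr k n), IsZariskiClosed T → S ⊆ T → χ ∈ T}

/-- `μ` degenerates to `χ` if `χ` lies in the Zariski closure of the orbit of `μ`. -/
def degenerates {n : ℕ} (μ χ : AlgStr k n) : Prop :=
  χ ∈ zclosure (orbit μ)

/-- A proper degeneration: additionally `χ` is not isomorphic to `μ`. -/
def properlyDegenerates {n : ℕ} (μ χ : AlgStr k n) : Prop :=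
  degenerates μ χ ∧ χ ∉ orbit μ

/-- There is a chain of `m` proper degenerations starting at `μ`. -/
def hasChain {n : ℕ} (μ : AlgStr k n) (m : ℕ) : Prop :=
  ∃ c : ℕ → AlgStr k n, c m = μ ∧ ∀ i < m, properlyDegenerates (c (i + 1)) (c i)

/-- The level of `μ` is `m`: there is a chain of `m` proper degenerations starting
at `μ` but no chain of `m+1`. -/
def levelIs {n : ℕ} (μ : AlgStr k n) (m : ℕ) : Prop :=
  hasChain μ m ∧ ¬ hasChain μ (m + 1)

/-- The subalgebra generated by a set `s`. -/
def subalgGen {n : ℕ} (μ : AlgStr k n) (s : Set (Fin n → k)) :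
    Submodule k (Fin n → k) :=
  sInf {W | s ⊆ W ∧ ∀ x ∈ W, ∀ y ∈ W, μ x y ∈ W}

/-- The generation type of `μ` is `m`: `m` is the maximal dimension of a
one-generated subalgebra. -/
def genType {n : ℕ} (μ : AlgStr k n) (m : ℕ) : Prop :=
  IsGreatest {d : ℕ | ∃ a : Fin n → k, Module.finrank k ↥(subalgGen μ {a}) = d} m

/-- A standard `1`-generated algebra: it admits a grading `A = ⊕_{i ≥ 1} A_i` with
`dim A_1 = 1`, `A_i A_j ⊆ A_{i+j}`, generated by `A_1` as an algebra. -/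
def StandardOneGenerated {m : ℕ} (μ : AlgStr k m) : Prop :=
  ∃ A : ℕ → Submodule k (Fin m → k),
    A 0 = ⊥ ∧ DirectSum.IsInternal A ∧ Module.finrank k ↥(A 1) = 1 ∧
    (∀ i j : ℕ, ∀ x ∈ A i, ∀ y ∈ A j, μ x y ∈ A (i + j)) ∧
    subalgGen μ ((A 1 : Submodule k (Fin m → k)) : Set (Fin m → k)) = ⊤

/-- Extension by zero of coordinates, `kᵐ → kⁿ`. -/
def inclMap (k : Type*) [Field k] {m n : ℕ} (h : m ≤ n) :
    (Fin m → k) →ₗ[k] (Fin n → k) where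
  toFun x i := if hi : (i : ℕ) < m then x ⟨i, hi⟩ else 0
  map_add' x y := by funext i; by_cases hi : (i : ℕ) < m <;> simp [hi]
  map_smul' a x := by funext i; by_cases hi : (i : ℕ) < m <;> simp [hi]

/-- The `n`-dimensional algebra `B ⊕ k^{n-m}` obtained from an `m`-dimensional
algebra `B` by adjoining a complement with all products zero. -/
def extendZero {m n : ℕ} (h : m ≤ n) (B : AlgStr k m) : AlgStr k n :=
  ((B.comp (LinearMap.funLeft k k (Fin.castLE h))).compl₂
      (LinearMap.funLeft k k (Fin.castLE h))).compr₂ (inclMap k h)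

/-- The `i`-th standard basis vector (as a plain function, `0` if `i ≥ n`). -/
def unitVec {k : Type*} [Field k] (n i : ℕ) : Fin n → k :=
  fun j => if (j : ℕ) = i then 1 else 0

/-- Projection onto the coordinate `0` part. -/
def proj0 (k : Type*) [Field k] (n : ℕ) : (Fin n → k) →ₗ[k] (Fin n → k) :=
  LinearMap.pi fun i => if (i : ℕ) = 0 then LinearMap.proj i else 0

/-- Projection onto the coordinates `≥ 1` part. -/
def projPos (k : Type*) [Field k] (n : ℕ) : (Fin n → k) →ₗ[k] (Fin n → k) :=
  LinearMap.pi fun i => if (i : ℕ) = 0 then 0 else LinearMap.proj i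

/-- The Inönü–Wigner contraction of `μ` with respect to the `1`-dimensional
subalgebra spanned by the first basis vector (the remaining coordinates form the
square-zero ideal part). -/
def IWcontract0 {n : ℕ} (μ : AlgStr k n) : AlgStr k n :=
  ((μ.comp (projPos k n)).compl₂ (proj0 k n)).compr₂ (projPos k n) +
    ((μ.comp (proj0 k n)).compl₂ (projPos k n)).compr₂ (projPos k n) +
    (μ.comp (proj0 k n)).compl₂ (proj0 k n)

/-- The annihilator of an algebra structure. -/
def annihilator {n : ℕ} (μ : AlgStr k n) : Submodule k (Fin n → k) where
  carrier := {a | ∀ b, μ a b = 0 ∧ μ b a = 0}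
  add_mem' := by
    intro a b ha hb
    intro c
    constructor
    · rw [map_add, LinearMap.add_apply, (ha c).1, (hb c).1, add_zero]
    · rw [map_add, (ha c).2, (hb c).2, add_zero]
  zero_mem' := by
    intro b
    constructor
    · rw [map_zero, LinearMap.zero_apply]
    · rw [map_zero]
  smul_mem' := by
    intro t a ha b
    constructor
    · rw [map_smul, LinearMap.smul_apply, (ha b).1, smul_zero]
    · rw [map_smul, (ha b).2, smul_zero]

/-- `μ` has a square-zero (two-sided) ideal of codimension `1`. -/
def hasSqZeroIdealCodim1 {n : ℕ} (μ : AlgStr k n) : Prop :=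
  ∃ I : Submodule k (Fin n → k), Module.finrank k ↥I = n - 1 ∧
    (∀ x ∈ I, ∀ y : Fin n → k, μ x y ∈ I ∧ μ y x ∈ I) ∧
    ∀ x ∈ I, ∀ y ∈ I, μ x y = 0

/-- `a` (viewed as the sequence of parts `a 0 ≥ a 1 ≥ …`) is a partition of `N`. -/
def IsPartitionOf (a : ℕ → ℕ) (N : ℕ) : Prop :=
  (∀ i j : ℕ, i ≤ j → a j ≤ a i) ∧
    ∃ l : ℕ, (∀ i, l ≤ i → a i = 0) ∧ ∑ i ∈ Finset.range l, a i = N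

/-- The dominance order on partitions: `a ⪰ b`. -/
def Dominates (a b : ℕ → ℕ) : Prop :=
  ∀ m : ℕ, ∑ i ∈ Finset.range m, b i ≤ ∑ i ∈ Finset.range m, a i

/-- `a` is the Jordan type of the matrix `M` at the eigenvalue `lam`:
`a` is a partition of the generalized eigenspace dimension, and the parts of `a`
are the sizes of the Jordan blocks of `M` with eigenvalue `lam`, expressed via
the ranks of powers of `M - lam • 1`. -/
def IsJordanTypeAt {N : ℕ} (M : Matrix (Fin N) (Fin N) k) (lam : k) (a : ℕ → ℕ) :
    Prop :=
  IsPartitionOf a (N - ((M - lam • (1 : Matrix (Fin N) (Fin N) k)) ^ N).rank) ∧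
    ∀ p : ℕ, ((M - lam • (1 : Matrix (Fin N) (Fin N) k)) ^ p).rank =
      N - ∑ i ∈ Finset.range N, min (a i) p

/-- The full specter of `M` is `{(lam i, a i)}`: the `lam i` are pairwise distinct,
each `a i` is the (nonempty) Jordan type of `M` at `lam i`, and every eigenvalue
of `M` occurs among the `lam i`. -/
def IsFullSpecter {N : ℕ} (M : Matrix (Fin N) (Fin N) k) {l : ℕ}
    (lam : Fin l → k) (a : Fin l → ℕ → ℕ) : Prop :=
  Function.Injective lam ∧
    (∀ i, IsJordanTypeAt M (lam i) (a i) ∧ a i 0 ≠ 0) ∧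
    ∀ c : k, (∃ v : Fin N → k, v ≠ 0 ∧ M.mulVec v = c • v) → ∃ i, lam i = c

/-- There is a chain of `len` strict dominance steps of partitions of `N`
starting (on top) at `a`. -/
def partChain (a : ℕ → ℕ) (N len : ℕ) : Prop :=
  ∃ c : ℕ → ℕ → ℕ, (∀ i ≤ len, IsPartitionOf (c i) N) ∧ c len = a ∧
    ∀ i < len, Dominates (c (i + 1)) (c i) ∧ c (i + 1) ≠ c i

/-- The structure `T_α^M ∈ A_{m+1}`. -/
def Tstr {m : ℕ} (α : k) (M : Matrix (Fin m) (Fin m) k) : AlgStr k (m + 1) :=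
  ofConst fun i j mm =>
    if hi : i = 0 then
      if hj : j = 0 then (if mm = 0 then α else 0)
      else if hmm : mm = 0 then 0 else M (mm.pred hmm) (j.pred hj)
    else if hj : j = 0 then
      if hmm : mm = 0 then 0 else (if i = mm then α else 0) - M (mm.pred hmm) (i.pred hi)
    else 0

/-- The trivial singular extension `k^{n-2} ⋊_{(L₁,R₁,L₂,R₂)} χ` of the
`2`-dimensional algebra `χ` given by the coefficients `c11, c12, c21, d12, d21, d22`
(with `χ(e₁,e₁) = c11·e₁ + e₂`, `χ(e₁,e₂) = c12·e₁ + d12·e₂`,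
`χ(e₂,e₁) = c21·e₁ + d21·e₂`, `χ(e₂,e₂) = d22·e₂`). -/
def sdExt {m : ℕ} (c11 c12 c21 d12 d21 d22 : k)
    (L1 R1 L2 R2 : Matrix (Fin m) (Fin m) k) : AlgStr k (m + 2) :=
  ofConst fun i j mm =>
    if hi0 : (i : ℕ) = 0 then
      if hj0 : (j : ℕ) = 0 then
        if (mm : ℕ) = 0 then c11 else if (mm : ℕ) = 1 then 1 else 0
      else if hj1 : (j : ℕ) = 1 then
        if (mm : ℕ) = 0 then c12 else if (mm : ℕ) = 1 then d12 else 0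
      else if hmm : (mm : ℕ) < 2 then 0
      else L1 ⟨(mm : ℕ) - 2, by have := mm.isLt; omega⟩
             ⟨(j : ℕ) - 2, by have := j.isLt; omega⟩
    else if hi1 : (i : ℕ) = 1 then
      if hj0 : (j : ℕ) = 0 then
        if (mm : ℕ) = 0 then c21 else if (mm : ℕ) = 1 then d21 else 0
      else if hj1 : (j : ℕ) = 1 then
        if (mm : ℕ) = 1 then d22 else 0
      else if hmm : (mm : ℕ) < 2 then 0
      else L2 ⟨(mm : ℕ) - 2, by have := mm.isLt; omega⟩
             ⟨(j : ℕ) - 2, by have := j.isLt; omega⟩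
    else
      if hj0 : (j : ℕ) = 0 then
        if hmm : (mm : ℕ) < 2 then 0
        else R1 ⟨(mm : ℕ) - 2, by have := mm.isLt; omega⟩
               ⟨(i : ℕ) - 2, by have := i.isLt; omega⟩
      else if hj1 : (j : ℕ) = 1 then
        if hmm : (mm : ℕ) < 2 then 0
        else R2 ⟨(mm : ℕ) - 2, by have := mm.isLt; omega⟩
               ⟨(i : ℕ) - 2, by have := i.isLt; omega⟩
      else 0

/-! Concrete algebra structures, given by multiplication tables on the standard
basis `e₁, …, eₙ` (0-indexed as `0, …, n-1`); all unspecified products are zero. -/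

/-- `A₃ ⊕ k^{n-2}`: `e₁e₁ = e₂`. -/
def A3str (n : ℕ) : AlgStr k n :=
  ofConst fun i j m => if (i : ℕ) = 0 ∧ (j : ℕ) = 0 ∧ (m : ℕ) = 1 then 1 else 0

/-- `n₃ ⊕ k^{n-3}`: `e₁e₂ = e₃`, `e₂e₁ = -e₃`. -/
def n3str (n : ℕ) : AlgStr k n :=
  ofConst fun i j m =>
    if (i : ℕ) = 0 ∧ (j : ℕ) = 1 ∧ (m : ℕ) = 2 then 1
    else if (i : ℕ) = 1 ∧ (j : ℕ) = 0 ∧ (m : ℕ) = 2 then -1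
    else 0

/-- `p⁻`: `e₁eᵢ = eᵢ`, `eᵢe₁ = -eᵢ` for `i ≥ 2`. -/
def pminusStr (n : ℕ) : AlgStr k n :=
  ofConst fun i j m =>
    if (i : ℕ) = 0 ∧ 1 ≤ (j : ℕ) ∧ m = j then 1
    else if 1 ≤ (i : ℕ) ∧ (j : ℕ) = 0 ∧ m = i then -1
    else 0

/-- `ν^α`: `e₁e₁ = e₁`, `e₁eᵢ = α eᵢ`, `eᵢe₁ = (1-α) eᵢ` for `i ≥ 2`. -/
def nuStr (n : ℕ) (α : k) : AlgStr k n :=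
  ofConst fun i j m =>
    if (i : ℕ) = 0 then
      if (j : ℕ) = 0 then (if (m : ℕ) = 0 then 1 else 0)
      else (if m = j then α else 0)
    else if (j : ℕ) = 0 then (if m = i then 1 - α else 0)
    else 0

/-- `k^{n-2} ⋊ E₄`: `e₁e₁ = e₁`, `e₁e₂ = e₁ + e₂`, `e₂e₂ = e₂`,
`e₁eᵢ = eᵢ`, `eᵢe₂ = eᵢ` for `i ≥ 3`.  (For `n = 2` this is `E₄`.) -/
def kE4str (n : ℕ) : AlgStr k n :=
  ofConst fun i j m =>
    if (i : ℕ) = 0 ∧ (j : ℕ) = 0 then (if (m : ℕ) = 0 then 1 else 0)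
    else if (i : ℕ) = 0 ∧ (j : ℕ) = 1 then (if (m : ℕ) = 0 ∨ (m : ℕ) = 1 then 1 else 0)
    else if (i : ℕ) = 1 ∧ (j : ℕ) = 1 then (if (m : ℕ) = 1 then 1 else 0)
    else if (i : ℕ) = 0 ∧ 2 ≤ (j : ℕ) then (if m = j then 1 else 0)
    else if 2 ≤ (i : ℕ) ∧ (j : ℕ) = 1 then (if m = i then 1 else 0)
    else 0

/-- `T₀^{2,(α,β)}`: `e₁e₂ = αe₂ + e₃`, `e₂e₁ = -αe₂ - e₃`,
`e₁eᵢ = βeᵢ`, `eᵢe₁ = -βeᵢ` for `i ≥ 3`. -/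
def T02str (n : ℕ) (α β : k) : AlgStr k n :=
  ofConst fun i j m =>
    if (i : ℕ) = 0 ∧ (j : ℕ) = 1 then
      (if (m : ℕ) = 1 then α else if (m : ℕ) = 2 then 1 else 0)
    else if (i : ℕ) = 1 ∧ (j : ℕ) = 0 then
      (if (m : ℕ) = 1 then -α else if (m : ℕ) = 2 then -1 else 0)
    else if (i : ℕ) = 0 ∧ 2 ≤ (j : ℕ) then (if m = j then β else 0)
    else if 2 ≤ (i : ℕ) ∧ (j : ℕ) = 0 then (if m = i then -β else 0)
    else 0

/-- `T₁^{2,(α,β)}`: `e₁e₁ = e₁`, `e₁e₂ = αe₂ + e₃`, `e₂e₁ = (1-α)e₂ - e₃`,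
`e₁eᵢ = βeᵢ`, `eᵢe₁ = (1-β)eᵢ` for `i ≥ 3`. -/
def T12str (n : ℕ) (α β : k) : AlgStr k n :=
  ofConst fun i j m =>
    if (i : ℕ) = 0 ∧ (j : ℕ) = 0 then (if (m : ℕ) = 0 then 1 else 0)
    else if (i : ℕ) = 0 ∧ (j : ℕ) = 1 then
      (if (m : ℕ) = 1 then α else if (m : ℕ) = 2 then 1 else 0)
    else if (i : ℕ) = 1 ∧ (j : ℕ) = 0 then
      (if (m : ℕ) = 1 then 1 - α else if (m : ℕ) = 2 then -1 else 0)
    else if (i : ℕ) = 0 ∧ 2 ≤ (j : ℕ) then (if m = j then β else 0)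
    else if 2 ≤ (i : ℕ) ∧ (j : ℕ) = 0 then (if m = i then 1 - β else 0)
    else 0

/-- `T₀³`: `e₁e₂ = e₃`, `e₂e₁ = -e₃`, `e₁e₃ = e₄`, `e₃e₁ = -e₄`. -/
def T03str (n : ℕ) : AlgStr k n :=
  ofConst fun i j m =>
    if (i : ℕ) = 0 ∧ (j : ℕ) = 1 ∧ (m : ℕ) = 2 then 1
    else if (i : ℕ) = 1 ∧ (j : ℕ) = 0 ∧ (m : ℕ) = 2 then -1
    else if (i : ℕ) = 0 ∧ (j : ℕ) = 2 ∧ (m : ℕ) = 3 then 1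
    else if (i : ℕ) = 2 ∧ (j : ℕ) = 0 ∧ (m : ℕ) = 3 then -1
    else 0

/-- `T₀^{2,2}`: `e₁e₂ = e₃`, `e₂e₁ = -e₃`, `e₁e₄ = e₅`, `e₄e₁ = -e₅`. -/
def T022str (n : ℕ) : AlgStr k n :=
  ofConst fun i j m =>
    if (i : ℕ) = 0 ∧ (j : ℕ) = 1 ∧ (m : ℕ) = 2 then 1
    else if (i : ℕ) = 1 ∧ (j : ℕ) = 0 ∧ (m : ℕ) = 2 then -1
    else if (i : ℕ) = 0 ∧ (j : ℕ) = 3 ∧ (m : ℕ) = 4 then 1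
    else if (i : ℕ) = 3 ∧ (j : ℕ) = 0 ∧ (m : ℕ) = 4 then -1
    else 0

/-- `η_l ⊕ k^{n-2l-1}`: `e_{2i-1}e_{2i} = e_{2l+1}`, `e_{2i}e_{2i-1} = -e_{2l+1}`
for `1 ≤ i ≤ l`. -/
def etaStr (n l : ℕ) : AlgStr k n :=
  ofConst fun i j m =>
    if (i : ℕ) % 2 = 0 ∧ (j : ℕ) = (i : ℕ) + 1 ∧ (i : ℕ) < 2 * l ∧ (m : ℕ) = 2 * l then 1
    else if (j : ℕ) % 2 = 0 ∧ (i : ℕ) = (j : ℕ) + 1 ∧ (j : ℕ) < 2 * l ∧ (m : ℕ) = 2 * l then -1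
    else 0

/-- `F^{α,β} ⊕ k^{n-3}`: `e₁e₁ = e₃`, `e₁e₂ = αe₃`, `e₂e₁ = βe₃`. -/
def FabStr (n : ℕ) (α β : k) : AlgStr k n :=
  ofConst fun i j m =>
    if (i : ℕ) = 0 ∧ (j : ℕ) = 0 ∧ (m : ℕ) = 2 then 1
    else if (i : ℕ) = 0 ∧ (j : ℕ) = 1 ∧ (m : ℕ) = 2 then α
    else if (i : ℕ) = 1 ∧ (j : ℕ) = 0 ∧ (m : ℕ) = 2 then β
    else 0

/-- `k^{n-2} ⋊ A₃`: `e₁e₁ = e₂`, `e₁eᵢ = eᵢ`, `eᵢe₁ = -eᵢ` for `i ≥ 3`. -/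
def kA3str (n : ℕ) : AlgStr k n :=
  ofConst fun i j m =>
    if (i : ℕ) = 0 ∧ (j : ℕ) = 0 ∧ (m : ℕ) = 1 then 1
    else if (i : ℕ) = 0 ∧ 2 ≤ (j : ℕ) then (if m = j then 1 else 0)
    else if 2 ≤ (i : ℕ) ∧ (j : ℕ) = 0 then (if m = i then -1 else 0)
    else 0

/-- `k² ⋊_{α,β} A₃ ⊕ k^{n-4}`: `e₁e₁ = e₂`, `e₁e₃ = αe₄`, `e₃e₁ = βe₄`. -/
def k2A3str (n : ℕ) (α β : k) : AlgStr k n :=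
  ofConst fun i j m =>
    if (i : ℕ) = 0 ∧ (j : ℕ) = 0 ∧ (m : ℕ) = 1 then 1
    else if (i : ℕ) = 0 ∧ (j : ℕ) = 2 ∧ (m : ℕ) = 3 then α
    else if (i : ℕ) = 2 ∧ (j : ℕ) = 0 ∧ (m : ℕ) = 3 then β
    else 0

/-- `k^{n-2} ⋊_α A₁^α`: `e₁e₁ = e₁ + e₂`, `e₁eᵢ = αeᵢ`, `eᵢe₁ = (1-α)eᵢ` for `i ≥ 2`. -/
def kA1str (n : ℕ) (α : k) : AlgStr k n :=
  ofConst fun i j m =>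
    if (i : ℕ) = 0 ∧ (j : ℕ) = 0 then (if (m : ℕ) = 0 ∨ (m : ℕ) = 1 then 1 else 0)
    else if (i : ℕ) = 0 then (if m = j then α else 0)
    else if (j : ℕ) = 0 then (if m = i then 1 - α else 0)
    else 0

/-- `k^{n-2} ⋊₁ A₂`: `e₁e₁ = e₂`, `e₁eᵢ = eᵢ`, `eᵢe₁ = -eᵢ` for `i ≥ 2`. -/
def kA2str (n : ℕ) : AlgStr k n :=
  ofConst fun i j m =>
    if (i : ℕ) = 0 ∧ (j : ℕ) = 0 then (if (m : ℕ) = 1 then 1 else 0)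
    else if (i : ℕ) = 0 then (if m = j then 1 else 0)
    else if (j : ℕ) = 0 then (if m = i then -1 else 0)
    else 0

/-- `k^{n-2} ⋊₀ᵗ B₂^α`: `e₁eᵢ = αeᵢ`, `eᵢe₁ = (1-α)eᵢ` for `i ≥ 2`. -/
def ktB2str (n : ℕ) (α : k) : AlgStr k n :=
  ofConst fun i j m =>
    if (i : ℕ) = 0 ∧ 1 ≤ (j : ℕ) then (if m = j then α else 0)
    else if 1 ≤ (i : ℕ) ∧ (j : ℕ) = 0 then (if m = i then 1 - α else 0)
    else 0

/-- `k^{n-2} ⋊₀ᵗ D₂^{α,β}`: `e₁e₁ = e₁`, `e₁eᵢ = αeᵢ`, `eᵢe₁ = βeᵢ` for `i ≥ 2`. -/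
def ktD2str (n : ℕ) (α β : k) : AlgStr k n :=
  ofConst fun i j m =>
    if (i : ℕ) = 0 ∧ (j : ℕ) = 0 then (if (m : ℕ) = 0 then 1 else 0)
    else if (i : ℕ) = 0 then (if m = j then α else 0)
    else if (j : ℕ) = 0 then (if m = i then β else 0)
    else 0

/-! ### Bilinear structures in coordinates -/

open Module in
theorem algStr_apply_coord {n : ℕ} (μ : AlgStr k n) (x y : Fin n → k) (m : Fin n) :
    μ x y m = ∑ i, ∑ j, x i * y j * structConst μ (i, j, m) := by
  have hx : x = ∑ i, x i • (Pi.single i (1 : k) : Fin n → k) := by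
    ext j; simp [Finset.sum_apply, Pi.single_apply]
  have hy : y = ∑ i, y i • (Pi.single i (1 : k) : Fin n → k) := by
    ext j; simp [Finset.sum_apply, Pi.single_apply]
  conv_lhs => rw [hx, hy]
  simp only [map_sum, map_smul, LinearMap.sum_apply, LinearMap.smul_apply, Finset.sum_apply,
    Pi.smul_apply, smul_eq_mul, structConst, Finset.mul_sum]
  rw [Finset.sum_comm]
  exact Finset.sum_congr rfl fun i _ => Finset.sum_congr rfl fun j _ => by ring

theorem ofConst_apply {n : ℕ} (c : Fin n → Fin n → Fin n → k) (x y : Fin n → k) :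
    ofConst c x y = ∑ i, ∑ j, (x i * y j) • c i j := by
  simp [ofConst, LinearMap.sum_apply]

theorem structConst_ofConst {n : ℕ} (c : Fin n → Fin n → Fin n → k) (i j m : Fin n) :
    structConst (ofConst c) (i, j, m) = c i j m := by
  rw [structConst, ofConst_apply, Finset.sum_eq_single i, Finset.sum_eq_single j]
  · simp
  · intro l _ hl; simp [hl]
  · simp
  · intro l _ hl; simp [hl]
  · simp

theorem algStr_ext {n : ℕ} {μ χ : AlgStr k n}
    (h : ∀ i j m, structConst μ (i, j, m) = structConst χ (i, j, m)) : μ = χ := by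
  refine LinearMap.ext fun x => LinearMap.ext fun y => funext fun m => ?_
  simp only [algStr_apply_coord, h]

theorem algStr_ext_basis {n : ℕ} {ι : Type*} (b : Module.Basis ι k (Fin n → k))
    {μ χ : AlgStr k n} (h : ∀ i j, μ (b i) (b j) = χ (b i) (b j)) : μ = χ :=
  b.ext fun i => b.ext fun j => h i j

/-! ### Orbits -/

theorem transport_apply {n : ℕ} (g : (Fin n → k) ≃ₗ[k] (Fin n → k)) (μ : AlgStr k n)
    (x y : Fin n → k) : transport g μ x y = g (μ (g.symm x) (g.symm y)) := rfl

theorem mem_orbit_self {n : ℕ} (μ : AlgStr k n) : μ ∈ orbit μ :=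
  ⟨LinearEquiv.refl k _, rfl⟩

theorem mem_orbit_symm {n : ℕ} {μ χ : AlgStr k n} (h : χ ∈ orbit μ) : μ ∈ orbit χ := by
  obtain ⟨g, rfl⟩ := h
  refine ⟨g.symm, ?_⟩
  refine LinearMap.ext fun x => LinearMap.ext fun y => ?_
  simp [transport_apply]

theorem mem_orbit_trans {n : ℕ} {μ χ ψ : AlgStr k n} (h : χ ∈ orbit μ) (h' : ψ ∈ orbit χ) :
    ψ ∈ orbit μ := by
  obtain ⟨g, rfl⟩ := h
  obtain ⟨g', rfl⟩ := h'
  exact ⟨g.trans g', rfl⟩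

theorem mem_orbit_of_basis {n : ℕ} {μ χ : AlgStr k n} (b : Module.Basis (Fin n) k (Fin n → k))
    (h : ∀ i j m, b.repr (μ (b i) (b j)) m = structConst χ (i, j, m)) : χ ∈ orbit μ := by
  refine ⟨b.equivFun, algStr_ext fun i j m => ?_⟩
  have hs : ∀ i, b.equivFun.symm (Pi.single i 1) = b i := fun i => by
    rw [LinearEquiv.symm_apply_eq]
    ext j; simp [Pi.single_apply, eq_comm]
  rw [← h i j m]
  simp [structConst, transport_apply, hs]

/-! ### Regular functions and degenerations -/

/-- Coordinates of a vector-valued function lie in a given algebra of functions. -/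
def VecReg {X : Type*} (S : Subalgebra k (X → k)) {n : ℕ} (F : X → Fin n → k) : Prop :=
  ∀ i, (fun x => F x i) ∈ S

section VecReg

variable {X : Type*} {S : Subalgebra k (X → k)} {n : ℕ}

theorem VecReg.const (v : Fin n → k) : VecReg S (fun _ => v) := fun i =>
  S.algebraMap_mem (v i)

theorem VecReg.algStr_apply {M : X → AlgStr k n} (hM : ∀ t, (fun x => structConst (M x) t) ∈ S)
    {F G : X → Fin n → k} (hF : VecReg S F) (hG : VecReg S G) :
    VecReg S (fun x => M x (F x) (G x)) := by
  intro m
  have : (fun x => M x (F x) (G x) m) =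
      ∑ i, ∑ j, (fun x => F x i) * (fun x => G x j) * (fun x => structConst (M x) (i, j, m)) := by
    funext x
    simp [algStr_apply_coord]
  rw [this]
  exact S.sum_mem fun i _ => S.sum_mem fun j _ => S.mul_mem (S.mul_mem (hF i) (hG j)) (hM _)

theorem VecReg.linear {m : ℕ} {F : X → Fin n → k} (hF : VecReg S F)
    (φ : (Fin n → k) →ₗ[k] (Fin m → k)) : VecReg S (fun x => φ (F x)) := by
  intro l
  have : (fun x => φ (F x) l) =
      ∑ i, φ (Pi.single i 1) l • (fun x => F x i) := by
    funext x
    have hx : F x = ∑ i, F x i • (Pi.single i (1 : k) : Fin n → k) := by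
      ext j; simp [Finset.sum_apply, Pi.single_apply]
    conv_lhs => rw [hx]
    simp [Finset.sum_apply, mul_comm]
  rw [this]
  exact S.sum_mem fun i _ => S.smul_mem (hF i) _

theorem VecReg.functional {F : X → Fin n → k} (hF : VecReg S F)
    (φ : (Fin n → k) →ₗ[k] k) : (fun x => φ (F x)) ∈ S :=
  hF.linear (LinearMap.pi fun _ : Fin 1 => φ) 0

theorem aeval_fun_mem {σ : Type*} {c : σ → X → k} (hc : ∀ s, c s ∈ S) (p : MvPolynomial σ k) :
    (fun x => MvPolynomial.eval (fun s => c s x) p) ∈ S := by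
  induction p using MvPolynomial.induction_on with
  | C a => simp only [MvPolynomial.eval_C]; exact S.algebraMap_mem a
  | add p q hp hq => simp only [map_add]; exact S.add_mem hp hq
  | mul_X p s hp => simp only [map_mul, MvPolynomial.eval_X]; exact S.mul_mem hp (hc s)

end VecReg

/-- The polynomial functions of the structure constants. -/
def regFun (k : Type*) [Field k] (n : ℕ) : Subalgebra k (AlgStr k n → k) :=
  (MvPolynomial.aeval (R := k) fun t (μ : AlgStr k n) => structConst μ t).range

theorem mem_regFun {n : ℕ} {r : AlgStr k n → k} :
    r ∈ regFun k n ↔ ∃ p : MvPolynomial (Fin n × Fin n × Fin n) k,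
      ∀ μ, r μ = MvPolynomial.eval (structConst μ) p := by
  have key : ∀ (p : MvPolynomial (Fin n × Fin n × Fin n) k) (μ : AlgStr k n),
      MvPolynomial.aeval (R := k) (fun t (μ : AlgStr k n) => structConst μ t) p μ =
        MvPolynomial.eval (structConst μ) p := by
    intro p μ
    induction p using MvPolynomial.induction_on with
    | C a => simp
    | add p q hp hq => simp [hp, hq]
    | mul_X p s hp => simp [hp]
  constructor
  · rintro ⟨p, rfl⟩
    exact ⟨p, fun μ => key p μ⟩
  · rintro ⟨p, hp⟩
    exact ⟨p, funext fun μ => (key p μ).trans (hp μ).symm⟩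

theorem structConst_mem_regFun {n : ℕ} (t : Fin n × Fin n × Fin n) :
    (fun μ : AlgStr k n => structConst μ t) ∈ regFun k n :=
  mem_regFun.2 ⟨MvPolynomial.X t, fun μ => by simp⟩

theorem VecReg.mul {n : ℕ} {F G : AlgStr k n → Fin n → k} (hF : VecReg (regFun k n) F)
    (hG : VecReg (regFun k n) G) : VecReg (regFun k n) (fun μ => μ (F μ) (G μ)) :=
  VecReg.algStr_apply (M := fun μ => μ) structConst_mem_regFun hF hG

theorem isZariskiClosed_iff {n : ℕ} {T : Set (AlgStr k n)} :
    IsZariskiClosed T ↔ ∃ R : Set (AlgStr k n → k), R ⊆ regFun k n ∧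
      ∀ μ, μ ∈ T ↔ ∀ r ∈ R, r μ = 0 := by
  constructor
  · rintro ⟨P, hP⟩
    refine ⟨(fun p μ => MvPolynomial.eval (structConst μ) p) '' P, ?_, fun μ => ?_⟩
    · rintro _ ⟨p, _, rfl⟩
      exact mem_regFun.2 ⟨p, fun _ => rfl⟩
    · simp [hP μ]
  · rintro ⟨R, hR, hT⟩
    refine ⟨{p | (fun μ => MvPolynomial.eval (structConst μ) p) ∈ R}, fun μ => ?_⟩
    rw [hT μ]
    constructor
    · exact fun h p hp => h _ hp
    · intro h r hr
      obtain ⟨p, hp⟩ := mem_regFun.1 (hR hr)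
      have : r = fun μ => MvPolynomial.eval (structConst μ) p := funext hp
      rw [this]
      exact h p (by rw [Set.mem_ofPred_eq, ← this]; exact hr)

/-- `χ` lies in the closure of the orbit of `μ` iff every regular function vanishing on the
orbit vanishes at `χ`. -/
theorem degenerates_iff {n : ℕ} {μ χ : AlgStr k n} :
    degenerates μ χ ↔ ∀ r ∈ regFun k n, (∀ ν ∈ orbit μ, r ν = 0) → r χ = 0 := by
  constructor
  · intro h r hr h0
    have := h {ν | r ν = 0} (isZariskiClosed_iff.2 ⟨{r}, by simpa using hr, by simp⟩) h0
    exact this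
  · intro h T hT hsub
    obtain ⟨R, hR, hT⟩ := isZariskiClosed_iff.1 hT
    rw [hT]
    exact fun r hr => h r (hR hr) fun ν hν => (hT ν).1 (hsub hν) r hr

theorem regFun_comp_transport {n : ℕ} {r : AlgStr k n → k} (hr : r ∈ regFun k n)
    (g : (Fin n → k) ≃ₗ[k] (Fin n → k)) : (fun ν => r (transport g ν)) ∈ regFun k n := by
  obtain ⟨p, hp⟩ := mem_regFun.1 hr
  have : (fun ν => r (transport g ν)) =
      fun ν => MvPolynomial.eval (fun t => structConst (transport g ν) t) p := by
    funext ν; rw [hp]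
  rw [this]
  refine aeval_fun_mem (fun t => ?_) p
  exact (((VecReg.const _).mul (VecReg.const _)).linear g.toLinearMap) t.2.2

theorem degenerates_of_mem_orbit {n : ℕ} {μ χ : AlgStr k n} (h : χ ∈ orbit μ) :
    degenerates μ χ := fun _ _ hT => hT h

theorem degenerates.trans {n : ℕ} {μ χ ψ : AlgStr k n} (h : degenerates μ χ)
    (h' : degenerates χ ψ) : degenerates μ ψ := by
  rw [degenerates_iff] at *
  intro r hr h0
  refine h' r hr ?_
  rintro _ ⟨g, rfl⟩
  refine h _ (regFun_comp_transport hr g) fun ν hν => h0 _ ?_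
  exact mem_orbit_trans hν ⟨g, rfl⟩

theorem aeval_id_fun_apply (p : Polynomial k) (t : k) :
    Polynomial.aeval (R := k) (id : k → k) p t = p.eval t := by
  induction p using Polynomial.induction_on' with
  | add p q hp hq => rw [map_add, Pi.add_apply, hp, hq, Polynomial.eval_add]
  | monomial m a => simp

theorem polynomial_fun_eq_zero [Infinite k] {f : k → k}
    (hf : f ∈ (Polynomial.aeval (R := k) (id : k → k)).range) (h : ∀ t, t ≠ 0 → f t = 0) :
    f = 0 := by
  obtain ⟨p, rfl⟩ := hf
  have hp : p * Polynomial.X = 0 := by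
    refine Polynomial.funext fun t => ?_
    by_cases ht : t = 0
    · simp [ht]
    · have := h t ht
      have h2 : p.eval t = 0 := (aeval_id_fun_apply p t).symm.trans this
      simp [h2]
  have : p = 0 := by simpa using hp
  simp [this]

/-- Contraction along a weighted basis. -/
theorem degenerates_of_weights [Infinite k] {n : ℕ} {μ χ : AlgStr k n}
    (b : Module.Basis (Fin n) k (Fin n → k)) (w : Fin n → ℕ)
    (h : ∀ i j m, (w i + w j < w m → b.repr (μ (b i) (b j)) m = 0 ∧ structConst χ (i, j, m) = 0) ∧
      (w i + w j = w m → b.repr (μ (b i) (b j)) m = structConst χ (i, j, m)) ∧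
      (w m < w i + w j → structConst χ (i, j, m) = 0)) : degenerates μ χ := by
  classical
  rw [degenerates_iff]
  intro r hr h0
  let F : k → AlgStr k n := fun t => ofConst fun i j m =>
    if w m ≤ w i + w j then t ^ (w i + w j - w m) * b.repr (μ (b i) (b j)) m else 0
  have hF0 : F 0 = χ := by
    refine algStr_ext fun i j m => ?_
    simp only [F, structConst_ofConst]
    obtain ⟨h1, h2, h3⟩ := h i j m
    rcases lt_trichotomy (w i + w j) (w m) with hlt | heq | hgt
    · rw [if_neg (by omega)]
      exact (h1 hlt).2.symm
    · rw [if_pos (by omega), h2 heq, heq]; simp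
    · rw [if_pos (by omega), h3 hgt, zero_pow (by omega), zero_mul]
  have hF : ∀ t, t ≠ 0 → F t ∈ orbit μ := by
    intro t ht
    refine mem_orbit_of_basis (b.unitsSMul fun i => (Units.mk0 t ht) ^ w i) fun i j m => ?_
    simp only [F, structConst_ofConst]
    rw [Module.Basis.repr_unitsSMul]
    simp only [Module.Basis.unitsSMul_apply, Units.smul_def, map_smul, LinearMap.smul_apply,
      Finsupp.smul_apply, smul_eq_mul, Units.val_pow_eq_pow_val, Units.val_mk0,
      Units.val_inv_eq_inv_val, ← inv_pow]
    split_ifs with hw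
    · obtain ⟨d, hd⟩ := Nat.exists_eq_add_of_le hw
      have : t ^ w i * t ^ w j = t ^ w m * t ^ d := by rw [← pow_add, ← pow_add, hd]
      rw [hd, Nat.add_sub_cancel_left]
      have h2 : t⁻¹ ^ w m * t ^ w m = 1 := by rw [← mul_pow, inv_mul_cancel₀ ht, one_pow]
      linear_combination (t⁻¹ ^ w m * (b.repr (μ (b i) (b j))) m) * this +
        t ^ d * (b.repr (μ (b i) (b j))) m * h2
    · rw [((h i j m).1 (by omega)).1]; simp
  have hreg : (fun t => r (F t)) ∈ (Polynomial.aeval (R := k) (id : k → k)).range := by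
    obtain ⟨p, hp⟩ := mem_regFun.1 hr
    have : (fun t => r (F t)) = fun t => MvPolynomial.eval (fun s => structConst (F t) s) p := by
      funext t; rw [hp]
    rw [this]
    refine aeval_fun_mem (fun s => ?_) p
    obtain ⟨i, j, m⟩ := s
    simp only [F, structConst_ofConst]
    split_ifs
    · refine ⟨Polynomial.C (b.repr (μ (b i) (b j)) m) * Polynomial.X ^ (w i + w j - w m), ?_⟩
      funext t
      refine (aeval_id_fun_apply _ t).trans ?_
      rw [Polynomial.eval_mul, Polynomial.eval_C, Polynomial.eval_pow, Polynomial.eval_X, mul_comm]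
    · exact Subalgebra.zero_mem _
  have := polynomial_fun_eq_zero hreg fun t ht => h0 _ (hF t ht)
  rw [← hF0]
  exact congrFun this 0

/-! ### Bases adapted to a subspace -/

theorem exists_basis_extend {n m : ℕ} (v : Fin m → Fin n → k) (hv : LinearIndependent k v)
    (W : Submodule k (Fin n → k)) (hW : Submodule.span k (Set.range v) ⊔ W = ⊤) :
    ∃ b : Module.Basis (Fin n) k (Fin n → k),
      (∀ (i : Fin n) (h : (i : ℕ) < m), b i = v ⟨i, h⟩) ∧ ∀ i : Fin n, m ≤ (i : ℕ) → b i ∈ W := by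
  set S := Submodule.span k (Set.range v) with hS
  obtain ⟨D, hD⟩ := Submodule.exists_isCompl (S ⊓ W)
  have hdisj : Disjoint S (D ⊓ W) := by
    rw [disjoint_iff]
    have := hD.inf_eq_bot
    rw [← this, inf_comm D W, inf_assoc]
  have hsup : S ⊔ (D ⊓ W) = ⊤ := by
    have h1 : (S ⊓ W) ⊔ (D ⊓ W) = W := by
      rw [← sup_inf_assoc_of_le D (inf_le_right : S ⊓ W ≤ W), hD.sup_eq_top, top_inf_eq]
    rw [eq_top_iff, ← hW]
    refine sup_le le_sup_left ?_
    calc W = (S ⊓ W) ⊔ (D ⊓ W) := h1.symm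
      _ ≤ _ := sup_le_sup_right inf_le_left _
  have hcompl : IsCompl S (D ⊓ W) := ⟨hdisj, codisjoint_iff.2 hsup⟩
  set C := D ⊓ W
  have hcard : m + Module.finrank k C = n := by
    have := Submodule.finrank_add_eq_of_isCompl hcompl
    rwa [finrank_span_eq_card hv, Fintype.card_fin, Module.finrank_fin_fun] at this
  let bC := Module.finBasis k C
  have hli : LinearIndependent k (Sum.elim v (fun i => (bC i : Fin n → k))) := by
    refine hv.sum_type (bC.linearIndependent.map' C.subtype C.ker_subtype) ?_
    refine hdisj.mono_right ?_
    rw [Submodule.span_le]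
    rintro _ ⟨i, rfl⟩
    exact (bC i).2
  let e : Fin m ⊕ Fin (Module.finrank k C) ≃ Fin n := finSumFinEquiv.trans (finCongr hcard)
  have hli' := hli.comp e.symm e.symm.injective
  let b : Module.Basis (Fin n) k (Fin n → k) := Module.Basis.mk hli' (by
    rw [hli'.span_eq_top_of_card_eq_finrank' (by simp)])
  refine ⟨b, fun i h => ?_, fun i h => ?_⟩
  · have : e.symm i = Sum.inl ⟨i, h⟩ := by
      rw [Equiv.symm_apply_eq]; ext; simp [e]
    simp [b, this]
  · have : e.symm i = Sum.inr ⟨i - m, by omega⟩ := by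
      rw [Equiv.symm_apply_eq]; ext; simp [e]; omega
    simp only [b, Module.Basis.mk_apply, Function.comp_apply, this, Sum.elim_inr]
    exact (bC _).2.2

theorem exists_basis_extend_top {n m : ℕ} (v : Fin m → Fin n → k) (hv : LinearIndependent k v) :
    ∃ b : Module.Basis (Fin n) k (Fin n → k),
      ∀ (i : Fin n) (h : (i : ℕ) < m), b i = v ⟨i, h⟩ := by
  obtain ⟨b, hb, -⟩ := exists_basis_extend v hv ⊤ (by simp)
  exact ⟨b, hb⟩

/-! ### Alternating structures -/

/-- Anticommutativity: all squares vanish. -/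
def IsAlt {n : ℕ} (μ : AlgStr k n) : Prop := ∀ a, μ a a = 0

theorem IsAlt.neg {n : ℕ} {μ : AlgStr k n} (h : IsAlt μ) (x y : Fin n → k) :
    μ y x = -μ x y := by
  have h1 := h (x + y)
  simp only [map_add, LinearMap.add_apply, h x, h y, zero_add, add_zero] at h1
  exact eq_neg_of_add_eq_zero_left h1

theorem IsAlt.structConst_self {n : ℕ} {μ : AlgStr k n} (h : IsAlt μ) (i m : Fin n) :
    structConst μ (i, i, m) = 0 := by simp [structConst, h _]

theorem IsAlt.structConst_swap {n : ℕ} {μ : AlgStr k n} (h : IsAlt μ) (i j m : Fin n) :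
    structConst μ (j, i, m) = -structConst μ (i, j, m) := by
  simp [structConst, h.neg (Pi.single i 1)]

theorem isAlt_ofConst {n : ℕ} {c : Fin n → Fin n → Fin n → k} (h0 : ∀ i m, c i i m = 0)
    (h1 : ∀ i j m, i < j → c j i m = -c i j m) : IsAlt (ofConst c) := by
  have h2 : ∀ i j, c i j + c j i = 0 := by
    intro i j
    ext m
    rcases lt_trichotomy i j with h | rfl | h
    · simp [h1 i j m h]
    · simp [h0]
    · simp [h1 j i m h]
  intro a
  rw [ofConst_apply, ← Fintype.sum_prod_type' fun i j => (a i * a j) • c i j]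
  refine Finset.sum_involution (fun p _ => p.swap) ?_ ?_ ?_ ?_
  · rintro ⟨i, j⟩ _
    simp only [Prod.fst_swap, Prod.snd_swap]
    rw [mul_comm (a j), ← smul_add, h2, smul_zero]
  · rintro ⟨i, j⟩ _ hne heq
    obtain rfl : j = i := by simpa using congrArg Prod.fst heq
    exact hne (by rw [funext (h0 j)]; simp [← Pi.zero_def])
  · simp
  · simp

theorem degenerates_of_weights_alt [Infinite k] {n : ℕ} {μ χ : AlgStr k n} (hμ : IsAlt μ)
    (hχ : IsAlt χ) (b : Module.Basis (Fin n) k (Fin n → k)) (w : Fin n → ℕ)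
    (h : ∀ i j, i < j → ∀ m, (structConst χ (i, j, m) ≠ 0 → w i + w j = w m) ∧
      (w i + w j ≤ w m → b.repr (μ (b i) (b j)) m = structConst χ (i, j, m))) :
    degenerates μ χ := by
  have h' : ∀ i j m, (structConst χ (i, j, m) ≠ 0 → w i + w j = w m) ∧
      (w i + w j ≤ w m → b.repr (μ (b i) (b j)) m = structConst χ (i, j, m)) := by
    intro i j m
    rcases lt_trichotomy i j with hij | rfl | hij
    · exact h i j hij m
    · simp [hχ.structConst_self, hμ _]
    · rw [hχ.structConst_swap j i, hμ.neg (b j), map_neg, Finsupp.neg_apply, neg_inj, neg_ne_zero,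
        add_comm]
      exact h j i hij m
  refine degenerates_of_weights b w fun i j m => ⟨fun hw => ?_, fun hw => ?_, fun hw => ?_⟩
  · have h0 : structConst χ (i, j, m) = 0 := by
      by_contra h0
      have := (h' i j m).1 h0
      omega
    exact ⟨by rw [(h' i j m).2 hw.le, h0], h0⟩
  · exact (h' i j m).2 hw.le
  · by_contra h0
    have := (h' i j m).1 h0
    omega

theorem mem_orbit_of_basis_alt {n : ℕ} {μ χ : AlgStr k n} (hμ : IsAlt μ)
    (hχ : IsAlt χ) (b : Module.Basis (Fin n) k (Fin n → k))
    (h : ∀ i j, i < j → ∀ m, b.repr (μ (b i) (b j)) m = structConst χ (i, j, m)) :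
    χ ∈ orbit μ := by
  refine mem_orbit_of_basis b fun i j m => ?_
  rcases lt_trichotomy i j with hij | rfl | hij
  · exact h i j hij m
  · simp [hχ.structConst_self, hμ _]
  · rw [hχ.structConst_swap j i, hμ.neg (b j), map_neg, Finsupp.neg_apply, h j i hij m]

theorem isAlt_n3str (n : ℕ) : IsAlt (n3str n : AlgStr k n) :=
  isAlt_ofConst (fun i m => by grind) (fun i j m h => by grind)

theorem isAlt_pminusStr (n : ℕ) : IsAlt (pminusStr n : AlgStr k n) :=
  isAlt_ofConst (fun i m => by grind) (fun i j m h => by grind)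

theorem isAlt_T02str (n : ℕ) (α β : k) : IsAlt (T02str n α β) :=
  isAlt_ofConst (fun i m => by grind) (fun i j m h => by grind)

theorem isAlt_T03str (n : ℕ) : IsAlt (T03str n : AlgStr k n) :=
  isAlt_ofConst (fun i m => by grind) (fun i j m h => by grind (splits := 30))

theorem isAlt_T022str (n : ℕ) : IsAlt (T022str n : AlgStr k n) :=
  isAlt_ofConst (fun i m => by grind) (fun i j m h => by grind (splits := 30))

theorem isAlt_etaStr (n l : ℕ) : IsAlt (etaStr n l : AlgStr k n) :=
  isAlt_ofConst (fun i m => by grind) (fun i j m h => by grind)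

/-! ### Explicit degenerations -/

theorem le_of_linearIndependent {n m : ℕ} {v : Fin m → Fin n → k} (hv : LinearIndependent k v) :
    m ≤ n := by
  simpa using hv.fintype_card_le_finrank

theorem repr_self_of_val {n : ℕ} (b : Module.Basis (Fin n) k (Fin n → k)) {x : Fin n → k}
    {r : ℕ} (hr : r < n) (hx : x = b ⟨r, hr⟩) (m : Fin n) :
    b.repr x m = if (m : ℕ) = r then 1 else 0 := by
  subst hx
  rw [b.repr_self, Finsupp.single_apply]
  simp [Fin.ext_iff, eq_comm]

theorem degenerates_zero [Infinite k] {n : ℕ} {μ : AlgStr k n} (hμ : IsAlt μ) :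
    degenerates μ 0 :=
  degenerates_of_weights_alt hμ (fun _ => rfl) (Pi.basisFun k (Fin n)) (fun _ => 1)
    fun i j _ m => ⟨fun h => absurd (by simp [structConst]) h, fun h => by omega⟩

theorem degenerates_n3str [Infinite k] {n : ℕ} {μ : AlgStr k n} (hμ : IsAlt μ) {x y : Fin n → k}
    (h : LinearIndependent k ![x, y, μ x y]) : degenerates μ (n3str n) := by
  have hn := le_of_linearIndependent h
  obtain ⟨b, hb⟩ := exists_basis_extend_top _ h
  have b0 : b ⟨0, by omega⟩ = x := by
    rw [hb _ (by norm_num)]; rfl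
  have b1 : b ⟨1, by omega⟩ = y := by
    rw [hb _ (by norm_num)]; rfl
  have b2 : b ⟨2, by omega⟩ = μ x y := by
    rw [hb _ (by norm_num)]; rfl
  refine degenerates_of_weights_alt hμ (isAlt_n3str n) b (fun i => if (i : ℕ) < 2 then 1 else 2)
    fun i j hij m => ?_
  obtain ⟨i, hi⟩ := i
  obtain ⟨j, hj⟩ := j
  rw [Fin.mk_lt_mk] at hij
  simp only [n3str, structConst_ofConst]
  constructor
  · grind
  · intro hw
    obtain ⟨rfl, rfl⟩ : i = 0 ∧ j = 1 := by grind
    rw [b0, b1, repr_self_of_val b _ b2.symm]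
    simp

theorem degenerates_T022str [Infinite k] {n : ℕ} {μ : AlgStr k n} (hμ : IsAlt μ)
    {x u v : Fin n → k} (h : LinearIndependent k ![x, u, μ x u, v, μ x v]) :
    degenerates μ (T022str n) := by
  have hn := le_of_linearIndependent h
  obtain ⟨b, hb⟩ := exists_basis_extend_top _ h
  have b0 : b ⟨0, by omega⟩ = x := by
    rw [hb _ (by norm_num)]; rfl
  have b1 : b ⟨1, by omega⟩ = u := by
    rw [hb _ (by norm_num)]; rfl
  have b2 : b ⟨2, by omega⟩ = μ x u := by
    rw [hb _ (by norm_num)]; rfl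
  have b3 : b ⟨3, by omega⟩ = v := by
    rw [hb _ (by norm_num)]; rfl
  have b4 : b ⟨4, by omega⟩ = μ x v := by
    rw [hb _ (by norm_num)]; rfl
  refine degenerates_of_weights_alt hμ (isAlt_T022str n) b
    (fun i => if (i : ℕ) = 0 then 1 else if (i : ℕ) = 1 ∨ (i : ℕ) = 3 then 2 else 3)
    fun i j hij m => ?_
  obtain ⟨i, hi⟩ := i
  obtain ⟨j, hj⟩ := j
  rw [Fin.mk_lt_mk] at hij
  simp only [T022str, structConst_ofConst]
  constructor
  · grind
  · intro hw
    obtain ⟨rfl, rfl⟩ | ⟨rfl, rfl⟩ : i = 0 ∧ j = 1 ∨ i = 0 ∧ j = 3 := by grind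
    · rw [b0, b1, repr_self_of_val b _ b2.symm]
      simp
    · rw [b0, b3, repr_self_of_val b _ b4.symm]
      simp

theorem degenerates_T03str [Infinite k] {n : ℕ} {μ : AlgStr k n} (hμ : IsAlt μ)
    {x v : Fin n → k} (h : LinearIndependent k ![x, v, μ x v, μ x (μ x v)]) :
    degenerates μ (T03str n) := by
  have hn := le_of_linearIndependent h
  obtain ⟨b, hb⟩ := exists_basis_extend_top _ h
  have b0 : b ⟨0, by omega⟩ = x := by
    rw [hb _ (by norm_num)]; rfl
  have b1 : b ⟨1, by omega⟩ = v := by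
    rw [hb _ (by norm_num)]; rfl
  have b2 : b ⟨2, by omega⟩ = μ x v := by
    rw [hb _ (by norm_num)]; rfl
  have b3 : b ⟨3, by omega⟩ = μ x (μ x v) := by
    rw [hb _ (by norm_num)]; rfl
  refine degenerates_of_weights_alt hμ (isAlt_T03str n) b
    (fun i => if (i : ℕ) = 0 then 1 else if (i : ℕ) = 1 then 2 else if (i : ℕ) = 2 then 3 else 4)
    fun i j hij m => ?_
  obtain ⟨i, hi⟩ := i
  obtain ⟨j, hj⟩ := j
  rw [Fin.mk_lt_mk] at hij
  simp only [T03str, structConst_ofConst]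
  constructor
  · grind
  · intro hw
    obtain ⟨rfl, rfl⟩ | ⟨rfl, rfl⟩ : i = 0 ∧ j = 1 ∨ i = 0 ∧ j = 2 := by grind
    · rw [b0, b1, repr_self_of_val b _ b2.symm]
      simp
    · rw [b0, b2, repr_self_of_val b _ b3.symm]
      simp

theorem degenerates_etaStr [Infinite k] {n : ℕ} {μ : AlgStr k n} (hμ : IsAlt μ)
    {x y z t w : Fin n → k} (h : LinearIndependent k ![x, y, z, t, w]) (hxy : μ x y = w)
    (hzt : μ z t = w) (hxz : μ x z = 0) (hxt : μ x t = 0) (hyz : μ y z = 0) (hyt : μ y t = 0) :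
    degenerates μ (etaStr n 2) := by
  have hn := le_of_linearIndependent h
  obtain ⟨b, hb⟩ := exists_basis_extend_top _ h
  have b0 : b ⟨0, by omega⟩ = x := by
    rw [hb _ (by norm_num)]; rfl
  have b1 : b ⟨1, by omega⟩ = y := by
    rw [hb _ (by norm_num)]; rfl
  have b2 : b ⟨2, by omega⟩ = z := by
    rw [hb _ (by norm_num)]; rfl
  have b3 : b ⟨3, by omega⟩ = t := by
    rw [hb _ (by norm_num)]; rfl
  have b4 : b ⟨4, by omega⟩ = w := by
    rw [hb _ (by norm_num)]; rfl
  refine degenerates_of_weights_alt hμ (isAlt_etaStr n 2) b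
    (fun i => if (i : ℕ) < 4 then 1 else 2) fun i j hij m => ?_
  obtain ⟨i, hi⟩ := i
  obtain ⟨j, hj⟩ := j
  rw [Fin.mk_lt_mk] at hij
  simp only [etaStr, structConst_ofConst]
  constructor
  · grind
  · intro hw
    have : i < 4 ∧ j < 4 := by grind
    obtain ⟨hi4, hj4⟩ := this
    interval_cases i <;> interval_cases j <;> try omega
    · rw [b0, b1, hxy, repr_self_of_val b _ b4.symm]; simp
    · rw [b0, b2, hxz]; simp
    · rw [b0, b3, hxt]; simp
    · rw [b1, b2, hyz]; simp
    · rw [b1, b3, hyt]; simp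
    · rw [b2, b3, hzt, repr_self_of_val b _ b4.symm]; simp

theorem repr_T02 {n : ℕ} (hn : 3 ≤ n) (b : Module.Basis (Fin n) k (Fin n → k)) {α β : k}
    {j : Fin n} (hj : (j : ℕ) ≠ 0) {y : Fin n → k} {c : k}
    (h1 : (j : ℕ) = 1 → y = c • b ⟨0, by omega⟩ + α • b j + b ⟨2, by omega⟩)
    (h2 : 2 ≤ (j : ℕ) → y = c • b ⟨0, by omega⟩ + β • b j) (m : Fin n)
    (hm : (m : ℕ) ≠ 0 ∨ c = 0) :
    b.repr y m = structConst (T02str n α β) (⟨0, by omega⟩, j, m) := by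
  obtain ⟨j, hj'⟩ := j
  obtain ⟨m, hm'⟩ := m
  simp only [T02str, structConst_ofConst]
  rcases (show j = 1 ∨ 2 ≤ j by simp at hj; omega) with h | h
  · rw [h1 h]
    simp only [map_add, map_smul, Finsupp.add_apply, Finsupp.smul_apply, b.repr_self,
      Finsupp.single_apply, Fin.mk.injEq, smul_eq_mul]
    rcases hm with hm | hm <;> grind
  · rw [h2 h]
    simp only [map_add, map_smul, Finsupp.add_apply, Finsupp.smul_apply, b.repr_self,
      Finsupp.single_apply, Fin.mk.injEq, smul_eq_mul]
    rcases hm with hm | hm <;> grind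

theorem degenerates_T02str [Infinite k] {n : ℕ} (hn : 3 ≤ n) {μ : AlgStr k n} (hμ : IsAlt μ)
    (b : Module.Basis (Fin n) k (Fin n → k)) {α β : k}
    (h1 : ∃ c : k, μ (b ⟨0, by omega⟩) (b ⟨1, by omega⟩) =
      c • b ⟨0, by omega⟩ + α • b ⟨1, by omega⟩ + b ⟨2, by omega⟩)
    (h2 : ∀ j : Fin n, 2 ≤ (j : ℕ) → ∃ c : k, μ (b ⟨0, by omega⟩) (b j) =
      c • b ⟨0, by omega⟩ + β • b j) :
    degenerates μ (T02str n α β) := by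
  refine degenerates_of_weights_alt hμ (isAlt_T02str n α β) b
    (fun i => if (i : ℕ) = 0 then 0 else 1) fun i j hij m => ?_
  obtain ⟨i, hi⟩ := i
  have hj : (j : ℕ) ≠ 0 := by have := Fin.lt_def.1 hij; simp at this; omega
  constructor
  · simp only [T02str, structConst_ofConst]
    have := Fin.lt_def.1 hij
    grind (splits := 20)
  · intro hw
    obtain ⟨rfl, hm⟩ : i = 0 ∧ (m : ℕ) ≠ 0 := by grind
    rcases (show (j : ℕ) = 1 ∨ 2 ≤ (j : ℕ) by omega) with h | h
    · obtain ⟨c, hc⟩ := h1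
      obtain ⟨j, hj'⟩ := j
      obtain rfl : j = 1 := h
      exact repr_T02 hn b hj (fun _ => hc) (fun h' => by simp at h') m (Or.inl hm)
    · obtain ⟨c, hc⟩ := h2 j h
      exact repr_T02 hn b hj (fun h' => by omega) (fun _ => hc) m (Or.inl hm)

theorem mem_orbit_T02str {n : ℕ} (hn : 3 ≤ n) {μ : AlgStr k n} (hμ : IsAlt μ)
    (b : Module.Basis (Fin n) k (Fin n → k)) {α β : k}
    (h1 : μ (b ⟨0, by omega⟩) (b ⟨1, by omega⟩) = α • b ⟨1, by omega⟩ + b ⟨2, by omega⟩)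
    (h2 : ∀ j : Fin n, 2 ≤ (j : ℕ) → μ (b ⟨0, by omega⟩) (b j) = β • b j)
    (h3 : ∀ i j : Fin n, (i : ℕ) ≠ 0 → (j : ℕ) ≠ 0 → μ (b i) (b j) = 0) :
    T02str n α β ∈ orbit μ := by
  refine mem_orbit_of_basis_alt hμ (isAlt_T02str n α β) b fun i j hij m => ?_
  have hlt := Fin.lt_def.1 hij
  have hj : (j : ℕ) ≠ 0 := by omega
  obtain ⟨i, hi⟩ := i
  by_cases hi0 : i = 0
  · subst hi0
    rcases (show (j : ℕ) = 1 ∨ 2 ≤ (j : ℕ) by omega) with h | h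
    · obtain ⟨j, hj'⟩ := j
      obtain rfl : j = 1 := h
      exact repr_T02 hn b hj (c := 0) (fun _ => by rw [h1]; simp) (fun h' => by simp at h') m
        (Or.inr rfl)
    · exact repr_T02 hn b hj (c := 0) (fun h' => by omega) (fun _ => by rw [h2 j h]; simp) m
        (Or.inr rfl)
  · rw [h3 _ _ hi0 hj]
    simp only [T02str, structConst_ofConst]
    grind

theorem n3str_mem_orbit {n : ℕ} (hn : 3 ≤ n) {μ : AlgStr k n} (hμ : IsAlt μ)
    (b : Module.Basis (Fin n) k (Fin n → k))
    (h1 : μ (b ⟨0, by omega⟩) (b ⟨1, by omega⟩) = b ⟨2, by omega⟩)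
    (h2 : ∀ i j : Fin n, i < j → 2 ≤ (j : ℕ) → μ (b i) (b j) = 0) :
    n3str n ∈ orbit μ := by
  refine mem_orbit_of_basis_alt hμ (isAlt_n3str n) b fun i j hij m => ?_
  have hlt := Fin.lt_def.1 hij
  by_cases hj : 2 ≤ (j : ℕ)
  · rw [h2 i j hij hj]
    simp only [n3str, structConst_ofConst]
    grind
  · obtain ⟨i, hi⟩ := i
    obtain ⟨j, hj'⟩ := j
    simp only at hlt hj
    obtain ⟨rfl, rfl⟩ : i = 0 ∧ j = 1 := by omega
    rw [repr_self_of_val b _ h1, n3str, structConst_ofConst]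
    simp

theorem pminusStr_mem_orbit {n : ℕ} {μ : AlgStr k n} (f : (Fin n → k) →ₗ[k] k) (hf : f ≠ 0)
    (hμ : ∀ x y, μ x y = f x • y - f y • x) : pminusStr n ∈ orbit μ := by
  obtain ⟨x, hx⟩ : ∃ x, f x = 1 := by
    obtain ⟨x, hx⟩ := DFunLike.ne_iff.1 hf
    exact ⟨(f x)⁻¹ • x, by simpa using inv_mul_cancel₀ hx⟩
  have hx0 : x ≠ 0 := by rintro rfl; simp at hx
  obtain ⟨b, hb, hb'⟩ := exists_basis_extend ![x] (by simpa using hx0)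
    (LinearMap.ker f) (by
      rw [eq_top_iff]
      intro z _
      have : z = f z • x + (z - f z • x) := by abel
      rw [this]
      refine Submodule.add_mem_sup (Submodule.smul_mem _ _ (Submodule.subset_span ⟨0, rfl⟩)) ?_
      simp [hx])
  refine mem_orbit_of_basis_alt (fun a => by rw [hμ, sub_self]) (isAlt_pminusStr n) b
    fun i j hij m => ?_
  have hlt := Fin.lt_def.1 hij
  have hj : f (b j) = 0 := hb' j (by omega)
  rw [hμ, hj, zero_smul, sub_zero]
  simp only [pminusStr, structConst_ofConst, map_smul, Finsupp.smul_apply, b.repr_self,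
    Finsupp.single_apply, smul_eq_mul]
  by_cases hi : (i : ℕ) = 0
  · have : b i = x := by rw [hb i (by omega)]; simp
    rw [this, hx]
    grind
  · have : f (b i) = 0 := hb' i (by omega)
    rw [this]
    grind

/-! ### Coordinate-free forms of the standard structures -/

/-- The `i`-th coordinate, read as `0` when `i` is out of range. -/
def coord (k : Type*) [Field k] (n i : ℕ) : (Fin n → k) →ₗ[k] k :=
  if h : i < n then LinearMap.proj ⟨i, h⟩ else 0

theorem coord_unitVec_self {n i : ℕ} (h : i < n) : coord k n i (unitVec n i) = 1 := by
  simp [coord, h, unitVec]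

theorem coord_unitVec_of_ne {n i j : ℕ} (h : i ≠ j) : coord k n i (unitVec n j) = 0 := by
  unfold coord
  split_ifs <;> simp [unitVec, h]

theorem coord_single {n i : ℕ} (j : Fin n) :
    coord k n i (Pi.single j 1) = if i = (j : ℕ) then 1 else 0 := by
  unfold coord
  split_ifs with h h' h'
  · subst h'; simp
  · rw [LinearMap.proj_apply, Pi.single_apply, if_neg]
    rintro rfl
    exact h' rfl
  · have := j.2; omega
  · rfl

/-- The alternating structure `(x, y) ↦ f x • M y - f y • M x`. -/
def wedgeStr {n : ℕ} (f : (Fin n → k) →ₗ[k] k) (M : (Fin n → k) →ₗ[k] (Fin n → k)) :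
    AlgStr k n :=
  LinearMap.mk₂ k (fun x y => f x • M y - f y • M x)
    (fun x y z => by simp only [map_add]; module)
    (fun c x y => by simp only [map_smul, smul_eq_mul]; module)
    (fun x y z => by simp only [map_add]; module)
    (fun c x y => by simp only [map_smul, smul_eq_mul]; module)

theorem wedgeStr_apply {n : ℕ} (f : (Fin n → k) →ₗ[k] k) (M : (Fin n → k) →ₗ[k] (Fin n → k))
    (x y : Fin n → k) : wedgeStr f M x y = f x • M y - f y • M x := rfl

theorem pminusStr_eq (n : ℕ) : pminusStr n = wedgeStr (coord k n 0) LinearMap.id := by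
  refine algStr_ext fun i j m => ?_
  rw [pminusStr, structConst_ofConst]
  simp only [structConst, wedgeStr_apply, coord_single, LinearMap.id_apply, Pi.sub_apply,
    Pi.smul_apply, smul_eq_mul, Pi.single_apply]
  grind

theorem n3str_eq (n : ℕ) :
    n3str n = wedgeStr (coord k n 0) ((coord k n 1).smulRight (unitVec n 2)) := by
  refine algStr_ext fun i j m => ?_
  rw [n3str, structConst_ofConst]
  simp only [structConst, wedgeStr_apply, coord_single, LinearMap.smulRight_apply, Pi.sub_apply,
    Pi.smul_apply, smul_eq_mul, unitVec]
  grind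

theorem T03str_eq (n : ℕ) :
    T03str n = wedgeStr (coord k n 0)
      ((coord k n 1).smulRight (unitVec n 2) + (coord k n 2).smulRight (unitVec n 3)) := by
  refine algStr_ext fun i j m => ?_
  rw [T03str, structConst_ofConst]
  simp only [structConst, wedgeStr_apply, coord_single, LinearMap.smulRight_apply, Pi.sub_apply,
    Pi.smul_apply, smul_eq_mul, unitVec, LinearMap.add_apply, Pi.add_apply]
  grind (splits := 30)

theorem T022str_eq (n : ℕ) :
    T022str n = wedgeStr (coord k n 0)
      ((coord k n 1).smulRight (unitVec n 2) + (coord k n 3).smulRight (unitVec n 4)) := by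
  refine algStr_ext fun i j m => ?_
  rw [T022str, structConst_ofConst]
  simp only [structConst, wedgeStr_apply, coord_single, LinearMap.smulRight_apply, Pi.sub_apply,
    Pi.smul_apply, smul_eq_mul, unitVec, LinearMap.add_apply, Pi.add_apply]
  grind (splits := 30)

theorem etaStr_two_eq (n : ℕ) :
    etaStr n 2 = wedgeStr (coord k n 0) ((coord k n 1).smulRight (unitVec n 4)) +
      wedgeStr (coord k n 2) ((coord k n 3).smulRight (unitVec n 4)) := by
  refine algStr_ext fun i j m => ?_
  rw [etaStr, structConst_ofConst]
  simp only [structConst, wedgeStr_apply, coord_single, LinearMap.smulRight_apply, Pi.sub_apply,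
    Pi.smul_apply, smul_eq_mul, unitVec, LinearMap.add_apply, Pi.add_apply]
  by_cases hm : (m : ℕ) = 4
  · simp only [hm]
    grind (splits := 30)
  · simp [hm]

theorem T02str_eq {n : ℕ} (α β : k) :
    T02str n α β = wedgeStr (coord k n 0) (β • LinearMap.id +
      (coord k n 1).smulRight ((α - β) • unitVec n 1 + unitVec n 2)) := by
  refine algStr_ext fun i j m => ?_
  rw [T02str, structConst_ofConst]
  simp only [structConst, wedgeStr_apply, coord_single, LinearMap.smulRight_apply, Pi.sub_apply,
    Pi.smul_apply, smul_eq_mul, unitVec, LinearMap.add_apply, Pi.add_apply, LinearMap.smul_apply,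
    LinearMap.id_apply, Pi.single_apply]
  by_cases hi : (i : ℕ) = 0
  · by_cases hj : (j : ℕ) = 0
    · grind (splits := 30)
    · by_cases hj : (j : ℕ) = 1 <;> grind (splits := 30)
  · by_cases hi : (i : ℕ) = 1
    · grind (splits := 30)
    · grind (splits := 30)

theorem T02_form {n : ℕ} (hn : 3 ≤ n) {α β : k} {ν : AlgStr k n} (h : ν ∈ orbit (T02str n α β)) :
    ∃ (f g : (Fin n → k) →ₗ[k] k) (w : Fin n → k), f w = 0 ∧ g w = α - β ∧
      ∀ x y, ν x y = β • (f x • y - f y • x) + (f x * g y - f y * g x) • w := by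
  obtain ⟨g, rfl⟩ := h
  refine ⟨coord k n 0 ∘ₗ g.symm.toLinearMap, coord k n 1 ∘ₗ g.symm.toLinearMap,
    g ((α - β) • unitVec n 1 + unitVec n 2), ?_, ?_, fun x y => ?_⟩
  · simp [coord_unitVec_of_ne]
  · simp [coord_unitVec_of_ne, coord_unitVec_self (show 1 < n by omega)]
  · rw [transport_apply, T02str_eq, wedgeStr_apply]
    simp only [LinearMap.add_apply, LinearMap.smul_apply, LinearMap.id_apply,
      LinearMap.smulRight_apply, map_sub, map_smul, map_add, LinearEquiv.apply_symm_apply,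
      LinearMap.comp_apply, LinearEquiv.coe_coe]
    module

theorem T03_form {n : ℕ} {ν : AlgStr k n} (h : ν ∈ orbit (T03str n : AlgStr k n)) :
    ∃ (f : (Fin n → k) →ₗ[k] k) (M : (Fin n → k) →ₗ[k] (Fin n → k)), (∀ x, f (M x) = 0) ∧
      (∀ x, M (M (M x)) = 0) ∧ ∀ x y, ν x y = f x • M y - f y • M x := by
  obtain ⟨g, rfl⟩ := h
  refine ⟨coord k n 0 ∘ₗ g.symm.toLinearMap, g.toLinearMap ∘ₗ ((coord k n 1).smulRight
    (unitVec n 2) + (coord k n 2).smulRight (unitVec n 3)) ∘ₗ g.symm.toLinearMap, fun x => ?_,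
    fun x => ?_, fun x y => ?_⟩
  · simp [coord_unitVec_of_ne]
  · simp [coord_unitVec_of_ne]
  · rw [transport_apply, T03str_eq, wedgeStr_apply]
    simp

theorem T022_form {n : ℕ} {ν : AlgStr k n} (h : ν ∈ orbit (T022str n : AlgStr k n)) :
    ∃ (f : (Fin n → k) →ₗ[k] k) (M : (Fin n → k) →ₗ[k] (Fin n → k)), (∀ x, f (M x) = 0) ∧
      (∀ x, M (M x) = 0) ∧ ∀ x y, ν x y = f x • M y - f y • M x := by
  obtain ⟨g, rfl⟩ := h
  refine ⟨coord k n 0 ∘ₗ g.symm.toLinearMap, g.toLinearMap ∘ₗ ((coord k n 1).smulRight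
    (unitVec n 2) + (coord k n 3).smulRight (unitVec n 4)) ∘ₗ g.symm.toLinearMap, fun x => ?_,
    fun x => ?_, fun x y => ?_⟩
  · simp [coord_unitVec_of_ne]
  · simp [coord_unitVec_of_ne]
  · rw [transport_apply, T022str_eq, wedgeStr_apply]
    simp

theorem n3_form {n : ℕ} {ν : AlgStr k n} (h : ν ∈ orbit (n3str n : AlgStr k n)) :
    ∃ (f g : (Fin n → k) →ₗ[k] k) (w : Fin n → k), f w = 0 ∧ g w = 0 ∧
      ∀ x y, ν x y = (f x * g y - f y * g x) • w := by
  obtain ⟨g, rfl⟩ := h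
  refine ⟨coord k n 0 ∘ₗ g.symm.toLinearMap, coord k n 1 ∘ₗ g.symm.toLinearMap,
    g (unitVec n 2), ?_, ?_, fun x y => ?_⟩
  · simp [coord_unitVec_of_ne]
  · simp [coord_unitVec_of_ne]
  · rw [transport_apply, n3str_eq, wedgeStr_apply]
    simp only [LinearMap.smulRight_apply, map_sub, map_smul, LinearMap.comp_apply,
      LinearEquiv.coe_coe]
    module

theorem eta_form {n : ℕ} {ν : AlgStr k n} (h : ν ∈ orbit (etaStr n 2 : AlgStr k n)) :
    ∃ (ω : (Fin n → k) → (Fin n → k) → k) (w : Fin n → k), (∀ x (c : k), ω (c • w) x = 0) ∧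
      ∀ x y, ν x y = ω x y • w := by
  obtain ⟨g, rfl⟩ := h
  refine ⟨fun x y => coord k n 0 (g.symm x) * coord k n 1 (g.symm y) -
    coord k n 0 (g.symm y) * coord k n 1 (g.symm x) + (coord k n 2 (g.symm x) *
    coord k n 3 (g.symm y) - coord k n 2 (g.symm y) * coord k n 3 (g.symm x)),
    g (unitVec n 4), fun x c => ?_, fun x y => ?_⟩
  · simp [coord_unitVec_of_ne]
  · rw [transport_apply, etaStr_two_eq]
    simp only [LinearMap.add_apply, wedgeStr_apply, LinearMap.smulRight_apply, map_sub, map_smul,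
      map_add]
    module

theorem pminus_form {n : ℕ} {ν : AlgStr k n} (h : ν ∈ orbit (pminusStr n : AlgStr k n)) :
    ∃ f : (Fin n → k) →ₗ[k] k, ∀ x y, ν x y = f x • y - f y • x := by
  obtain ⟨g, rfl⟩ := h
  refine ⟨coord k n 0 ∘ₗ g.symm.toLinearMap, fun x y => ?_⟩
  rw [transport_apply, pminusStr_eq, wedgeStr_apply]
  simp

/-! ### Closed conditions obstructing degenerations -/

theorem regFun_functional {n : ℕ} {F : AlgStr k n → Fin n → k} (hF : VecReg (regFun k n) F)
    (φ : (Fin n → k) →ₗ[k] k) : (fun ν => φ (F ν)) ∈ regFun k n := hF.functional φ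

theorem regFun_mul {n : ℕ} {f g : AlgStr k n → k} (hf : f ∈ regFun k n) (hg : g ∈ regFun k n) :
    (fun ν => f ν * g ν) ∈ regFun k n := (regFun k n).mul_mem hf hg

theorem regFun_sub {n : ℕ} {f g : AlgStr k n → k} (hf : f ∈ regFun k n) (hg : g ∈ regFun k n) :
    (fun ν => f ν - g ν) ∈ regFun k n := (regFun k n).sub_mem hf hg

theorem regFun_add {n : ℕ} {f g : AlgStr k n → k} (hf : f ∈ regFun k n) (hg : g ∈ regFun k n) :
    (fun ν => f ν + g ν) ∈ regFun k n := (regFun k n).add_mem hf hg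

theorem regFun_const {n : ℕ} (c : k) : (fun _ : AlgStr k n => c) ∈ regFun k n :=
  (regFun k n).algebraMap_mem c

theorem degenerates.eq_zero {n : ℕ} {μ χ : AlgStr k n} (h : degenerates μ χ) {r : AlgStr k n → k}
    (hr : r ∈ regFun k n) (h0 : ∀ ν ∈ orbit μ, r ν = 0) : r χ = 0 :=
  degenerates_iff.1 h r hr h0

theorem eq_zero_of_functional {n : ℕ} {x : Fin n → k} (h : ∀ φ : (Fin n → k) →ₗ[k] k, φ x = 0) :
    x = 0 := funext fun i => h (LinearMap.proj i)

theorem degenerates.isAlt {n : ℕ} {μ χ : AlgStr k n} (h : degenerates μ χ) (hμ : IsAlt μ) :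
    IsAlt χ := by
  intro a
  refine eq_zero_of_functional fun φ => h.eq_zero (r := fun ν => φ (ν a a))
    (regFun_functional ((VecReg.const _).mul (VecReg.const _)) _) ?_
  rintro _ ⟨g, rfl⟩
  simp [transport_apply, hμ _]

theorem degenerates.mul_mul_eq_zero {n : ℕ} {μ χ : AlgStr k n} (h : degenerates μ χ)
    (hμ : ∀ ν ∈ orbit μ, ∀ x y z, ν (ν x y) z = 0) (x y z : Fin n → k) : χ (χ x y) z = 0 :=
  eq_zero_of_functional fun φ => h.eq_zero (r := fun ν => φ (ν (ν x y) z))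
    (regFun_functional (((VecReg.const _).mul (VecReg.const _)).mul (VecReg.const _)) _)
    fun ν hν => by rw [hμ ν hν, map_zero]

theorem degenerates.pluecker {n : ℕ} {μ χ : AlgStr k n} (h : degenerates μ χ)
    {φ : (Fin n → k) →ₗ[k] k} {x y z u : Fin n → k}
    (hμ : ∀ ν ∈ orbit μ, φ (ν x y) * φ (ν z u) - φ (ν x z) * φ (ν y u) +
      φ (ν x u) * φ (ν y z) = 0) :
    φ (χ x y) * φ (χ z u) - φ (χ x z) * φ (χ y u) + φ (χ x u) * φ (χ y z) = 0 := by
  refine h.eq_zero (r := fun ν => φ (ν x y) * φ (ν z u) - φ (ν x z) * φ (ν y u) +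
      φ (ν x u) * φ (ν y z)) ?_ hμ
  have key : ∀ a b, (fun ν : AlgStr k n => φ (ν a b)) ∈ regFun k n := fun a b =>
    regFun_functional ((VecReg.const _).mul (VecReg.const _)) _
  exact regFun_add (regFun_sub (regFun_mul (key _ _) (key _ _)) (regFun_mul (key _ _) (key _ _)))
    (regFun_mul (key _ _) (key _ _))

theorem degenerates.det_eq {n : ℕ} {μ χ : AlgStr k n} (h : degenerates μ χ)
    {φ ψ : (Fin n → k) →ₗ[k] k} {x y z u : Fin n → k}
    (hμ : ∀ ν ∈ orbit μ, φ (ν x y) * ψ (ν z u) - ψ (ν x y) * φ (ν z u) = 0) :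
    φ (χ x y) * ψ (χ z u) - ψ (χ x y) * φ (χ z u) = 0 := by
  refine h.eq_zero (r := fun ν => φ (ν x y) * ψ (ν z u) - ψ (ν x y) * φ (ν z u)) ?_ hμ
  have key : ∀ (φ : (Fin n → k) →ₗ[k] k) a b, (fun ν : AlgStr k n => φ (ν a b)) ∈ regFun k n :=
    fun φ a b => regFun_functional ((VecReg.const _).mul (VecReg.const _)) _
  exact regFun_sub (regFun_mul (key _ _ _) (key _ _ _)) (regFun_mul (key _ _ _) (key _ _ _))

/-- Structures degenerating to `T₀^{2,(α,β)}` with `(α, β) ≠ 0` are not nilpotent. -/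
theorem T02_mul_mul_ne_zero {n : ℕ} (hn : 3 ≤ n) {α β : k} (hαβ : (α, β) ≠ (0, 0)) :
    ∃ x y, T02str n α β (T02str n α β x y) x ≠ 0 := by
  by_contra! hc
  have h1 := congrArg (coord k n 1) (hc (unitVec n 0) (unitVec n 1))
  have h2 := congrArg (coord k n 2) (hc (unitVec n 0) (unitVec n 2))
  simp [T02str_eq, wedgeStr_apply, coord_unitVec_of_ne, coord_unitVec_self (show 1 < n by omega),
    coord_unitVec_self (show 0 < n by omega), coord_unitVec_self (show 2 < n by omega)] at h1 h2
  simp [h2] at h1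
  exact hαβ (by rw [h1, h2])

theorem not_degenerates_T02_of_nilpotent {n : ℕ} (hn : 3 ≤ n) {α β : k} (hαβ : (α, β) ≠ (0, 0))
    {μ : AlgStr k n} (hμ : ∀ ν ∈ orbit μ, ∀ x y z, ν (ν x y) z = 0) :
    ¬ degenerates μ (T02str n α β) := fun h => by
  obtain ⟨x, y, hxy⟩ := T02_mul_mul_ne_zero hn hαβ
  exact hxy (h.mul_mul_eq_zero hμ x y x)

theorem not_degenerates_T03_of_nilpotent {n : ℕ} (hn : 4 ≤ n)
    {μ : AlgStr k n} (hμ : ∀ ν ∈ orbit μ, ∀ x y z, ν (ν x y) z = 0) :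
    ¬ degenerates μ (T03str n) := fun h => by
  have h1 := congrArg (coord k n 3)
    (h.mul_mul_eq_zero hμ (unitVec n 0) (unitVec n 1) (unitVec n 0))
  simp [T03str_eq, wedgeStr_apply, coord_unitVec_of_ne, coord_unitVec_self (show 1 < n by omega),
    coord_unitVec_self (show 0 < n by omega), coord_unitVec_self (show 2 < n by omega),
    coord_unitVec_self (show 3 < n by omega)] at h1

theorem not_degenerates_eta_of_pluecker {n : ℕ} (hn : 5 ≤ n) {μ : AlgStr k n}
    (hμ : ∀ ν ∈ orbit μ, ∀ (φ : (Fin n → k) →ₗ[k] k) (x y z u : Fin n → k),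
      φ x = 0 → φ y = 0 → φ z = 0 → φ u = 0 →
      φ (ν x y) * φ (ν z u) - φ (ν x z) * φ (ν y u) + φ (ν x u) * φ (ν y z) = 0) :
    ¬ degenerates μ (etaStr n 2) := fun h => by
  have h1 := h.pluecker (φ := coord k n 4) (x := unitVec n 0) (y := unitVec n 1)
    (z := unitVec n 2) (u := unitVec n 3) fun ν hν => hμ ν hν _ _ _ _ _
      (coord_unitVec_of_ne (by simp)) (coord_unitVec_of_ne (by simp))
      (coord_unitVec_of_ne (by simp)) (coord_unitVec_of_ne (by simp))
  simp [etaStr_two_eq, wedgeStr_apply, coord_unitVec_of_ne,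
    coord_unitVec_self (show 1 < n by omega),
    coord_unitVec_self (show 0 < n by omega), coord_unitVec_self (show 2 < n by omega),
    coord_unitVec_self (show 3 < n by omega), coord_unitVec_self (show 4 < n by omega)] at h1

theorem not_degenerates_T022_of_det {n : ℕ} (hn : 5 ≤ n) {μ : AlgStr k n}
    (hμ : ∀ ν ∈ orbit μ, ∀ (φ ψ : (Fin n → k) →ₗ[k] k) (x y z : Fin n → k),
      φ x = 0 → ψ x = 0 → φ y = 0 → ψ y = 0 → φ z = 0 → ψ z = 0 →
      φ (ν x y) * ψ (ν x z) - ψ (ν x y) * φ (ν x z) = 0) :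
    ¬ degenerates μ (T022str n) := fun h => by
  have h1 := h.det_eq (φ := coord k n 2) (ψ := coord k n 4) (x := unitVec n 0) (y := unitVec n 1)
    (z := unitVec n 0) (u := unitVec n 3) fun ν hν => hμ ν hν _ _ _ _ _
      (coord_unitVec_of_ne (by simp)) (coord_unitVec_of_ne (by simp))
      (coord_unitVec_of_ne (by simp)) (coord_unitVec_of_ne (by simp))
      (coord_unitVec_of_ne (by simp)) (coord_unitVec_of_ne (by simp))
  simp [T022str_eq, wedgeStr_apply, coord_unitVec_of_ne, coord_unitVec_self (show 1 < n by omega),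
    coord_unitVec_self (show 0 < n by omega), coord_unitVec_self (show 2 < n by omega),
    coord_unitVec_self (show 3 < n by omega), coord_unitVec_self (show 4 < n by omega)] at h1

theorem T022_nilpotent {n : ℕ} : ∀ ν ∈ orbit (T022str n : AlgStr k n), ∀ x y z,
    ν (ν x y) z = 0 := by
  intro ν hν x y z
  obtain ⟨f, M, hf, hM, h⟩ := T022_form hν
  simp [h, hf, hM]

theorem eta_nilpotent {n : ℕ} : ∀ ν ∈ orbit (etaStr n 2 : AlgStr k n), ∀ x y z,
    ν (ν x y) z = 0 := by
  intro ν hν x y z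
  obtain ⟨ω, w, hω, h⟩ := eta_form hν
  rw [h x y, h, hω, zero_smul]

theorem n3_nilpotent {n : ℕ} : ∀ ν ∈ orbit (n3str n : AlgStr k n), ∀ x y z,
    ν (ν x y) z = 0 := by
  intro ν hν x y z
  obtain ⟨f, g, w, hf, hg, h⟩ := n3_form hν
  simp [h, hf, hg]

theorem T02_not_degenerates_T022 {n : ℕ} (hn : 5 ≤ n) (α β : k) :
    ¬ degenerates (T02str n α β) (T022str n) := by
  refine not_degenerates_T022_of_det hn fun ν hν φ ψ x y z h1 h2 h3 h4 h5 h6 => ?_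
  obtain ⟨f, g, w, hf, hg, h⟩ := T02_form (by omega) hν
  simp only [h, map_add, map_smul, map_sub, h1, h2, h3, h4, h5, h6, smul_eq_mul]
  ring

theorem T02_not_degenerates_eta {n : ℕ} (hn : 5 ≤ n) (α β : k) :
    ¬ degenerates (T02str n α β) (etaStr n 2) := by
  refine not_degenerates_eta_of_pluecker hn fun ν hν φ x y z u h1 h2 h3 h4 => ?_
  obtain ⟨f, g, w, hf, hg, h⟩ := T02_form (by omega) hν
  simp only [h, map_add, map_smul, map_sub, h1, h2, h3, h4, smul_eq_mul]
  ring

theorem T02_not_degenerates_T03 {n : ℕ} (hn : 4 ≤ n) (α β : k) :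
    ¬ degenerates (T02str n α β) (T03str n) := fun hd => by
  have key : ∀ ν ∈ orbit (T02str n α β), ∀ (φ ψ : (Fin n → k) →ₗ[k] k) (x y : Fin n → k),
      φ x = 0 → ψ x = 0 → φ y = 0 → ψ y = 0 →
      φ (ν x y) * ψ (ν x (ν x y)) - ψ (ν x y) * φ (ν x (ν x y)) = 0 := by
    intro ν hν φ ψ x y h1 h2 h3 h4
    obtain ⟨f, g, w, hf, hg, h⟩ := T02_form (by omega) hν
    simp only [h, map_add, map_smul, map_sub, h1, h2, h3, h4, smul_eq_mul, hf, hg]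
    ring
  have h1 := hd.eq_zero (r := fun ν => coord k n 2 (ν (unitVec n 0) (unitVec n 1)) *
    coord k n 3 (ν (unitVec n 0) (ν (unitVec n 0) (unitVec n 1))) -
    coord k n 3 (ν (unitVec n 0) (unitVec n 1)) *
    coord k n 2 (ν (unitVec n 0) (ν (unitVec n 0) (unitVec n 1)))) (by
      have key : ∀ (φ : (Fin n → k) →ₗ[k] k) a b,
          (fun ν : AlgStr k n => φ (ν a b)) ∈ regFun k n := fun φ a b =>
        regFun_functional ((VecReg.const _).mul (VecReg.const _)) _
      have key' : ∀ (φ : (Fin n → k) →ₗ[k] k) a b,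
          (fun ν : AlgStr k n => φ (ν a (ν a b))) ∈ regFun k n := fun φ a b =>
        regFun_functional ((VecReg.const _).mul ((VecReg.const _).mul (VecReg.const _))) _
      exact regFun_sub (regFun_mul (key _ _ _) (key' _ _ _)) (regFun_mul (key _ _ _) (key' _ _ _)))
    fun ν hν => key ν hν _ _ _ _ (coord_unitVec_of_ne (by simp)) (coord_unitVec_of_ne (by simp))
      (coord_unitVec_of_ne (by simp)) (coord_unitVec_of_ne (by simp))
  simp [T03str_eq, wedgeStr_apply, coord_unitVec_of_ne, coord_unitVec_self (show 1 < n by omega),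
    coord_unitVec_self (show 0 < n by omega), coord_unitVec_self (show 2 < n by omega),
    coord_unitVec_self (show 3 < n by omega)] at h1

theorem T03_not_degenerates_T02 {n : ℕ} (hn : 3 ≤ n) {α β : k} (hαβ : (α, β) ≠ (0, 0)) :
    ¬ degenerates (T03str n) (T02str n α β) := fun hd => by
  have key : ∀ x y, T02str n α β x (T02str n α β x (T02str n α β x y)) = 0 := by
    intro x y
    refine eq_zero_of_functional fun φ => hd.eq_zero (r := fun ν => φ (ν x (ν x (ν x y))))
      (regFun_functional ((VecReg.const _).mul ((VecReg.const _).mul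
        ((VecReg.const _).mul (VecReg.const _)))) _) fun ν hν => ?_
    obtain ⟨f, M, hf, hM, h⟩ := T03_form hν
    simp [h, hf, hM]
  have h1 := congrArg (coord k n 1) (key (unitVec n 0) (unitVec n 1))
  have h2 := congrArg (coord k n 2) (key (unitVec n 0) (unitVec n 2))
  simp [T02str_eq, wedgeStr_apply, coord_unitVec_of_ne, coord_unitVec_self (show 1 < n by omega),
    coord_unitVec_self (show 0 < n by omega), coord_unitVec_self (show 2 < n by omega)] at h1 h2
  simp [h2] at h1
  exact hαβ (by rw [h1, h2])

theorem T022_not_degenerates_eta {n : ℕ} (hn : 5 ≤ n) :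
    ¬ degenerates (T022str n : AlgStr k n) (etaStr n 2) := by
  refine not_degenerates_eta_of_pluecker hn fun ν hν φ x y z u _ _ _ _ => ?_
  obtain ⟨f, M, -, -, h⟩ := T022_form hν
  simp only [h, map_smul, map_sub, smul_eq_mul]
  ring

theorem eta_not_degenerates_T022 {n : ℕ} (hn : 5 ≤ n) :
    ¬ degenerates (etaStr n 2 : AlgStr k n) (T022str n) := by
  refine not_degenerates_T022_of_det hn fun ν hν φ ψ x y z _ _ _ _ _ _ => ?_
  obtain ⟨ω, w, -, h⟩ := eta_form hν
  simp only [h, map_smul, smul_eq_mul]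
  ring

theorem n3_not_degenerates_T022 {n : ℕ} (hn : 5 ≤ n) :
    ¬ degenerates (n3str n : AlgStr k n) (T022str n) := by
  refine not_degenerates_T022_of_det hn fun ν hν φ ψ x y z _ _ _ _ _ _ => ?_
  obtain ⟨f, g, w, -, -, h⟩ := n3_form hν
  simp only [h, map_smul, smul_eq_mul]
  ring

theorem n3_not_degenerates_eta {n : ℕ} (hn : 5 ≤ n) :
    ¬ degenerates (n3str n : AlgStr k n) (etaStr n 2) := by
  refine not_degenerates_eta_of_pluecker hn fun ν hν φ x y z u _ _ _ _ => ?_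
  obtain ⟨f, g, w, -, -, h⟩ := n3_form hν
  simp only [h, map_smul, smul_eq_mul]
  ring

theorem n3_not_degenerates_pminus {n : ℕ} (hn : 2 ≤ n) :
    ¬ degenerates (n3str n : AlgStr k n) (pminusStr n) := fun h => by
  have h1 := congrArg (coord k n 1)
    (h.mul_mul_eq_zero n3_nilpotent (unitVec n 0) (unitVec n 1) (unitVec n 0))
  simp [pminusStr_eq, wedgeStr_apply, coord_unitVec_of_ne, coord_unitVec_self (show 1 < n by omega),
    coord_unitVec_self (show 0 < n by omega)] at h1

theorem degenerates_pminus_dependent {n : ℕ} {χ : AlgStr k n} (h : degenerates (pminusStr n) χ)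
    (x y : Fin n → k) : ¬ LinearIndependent k ![x, y, χ x y] := fun hli => by
  obtain ⟨b, hb⟩ := exists_basis_extend_top _ hli
  have hn := le_of_linearIndependent hli
  have b0 : b ⟨0, by omega⟩ = x := by
    rw [hb _ (by norm_num)]; rfl
  have b1 : b ⟨1, by omega⟩ = y := by
    rw [hb _ (by norm_num)]; rfl
  have b2 : b ⟨2, by omega⟩ = χ x y := by
    rw [hb _ (by norm_num)]; rfl
  have hx : b.coord ⟨2, by omega⟩ x = 0 := by rw [← b0]; simp
  have hy : b.coord ⟨2, by omega⟩ y = 0 := by rw [← b1]; simp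
  have := h.eq_zero (r := fun ν => b.coord ⟨2, by omega⟩ (ν x y))
    (regFun_functional ((VecReg.const _).mul (VecReg.const _)) _) fun ν hν => by
      obtain ⟨f, hf⟩ := pminus_form hν
      rw [hf, map_sub, map_smul, map_smul, hx, hy]
      simp
  rw [← b2] at this
  simp at this

/-! ### Degenerations among the structures `T₀^{2,(α,β)}` -/

theorem T02_scale {n : ℕ} (hn : 3 ≤ n) {α β c : k} (hc : c ≠ 0) :
    T02str n (c * α) (c * β) ∈ orbit (T02str n α β) := by
  let b : Module.Basis (Fin n) k (Fin n → k) := (Pi.basisFun k (Fin n)).unitsSMul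
    fun i => if (i : ℕ) = 0 ∨ (i : ℕ) = 2 then Units.mk0 c hc else 1
  have hb : ∀ i : Fin n, b i = (if (i : ℕ) = 0 ∨ (i : ℕ) = 2 then c else 1) • unitVec n i := by
    intro i
    rw [Module.Basis.unitsSMul_apply, Pi.basisFun_apply, Units.smul_def]
    have : (Pi.single i 1 : Fin n → k) = unitVec n i := by
      ext j; simp [Pi.single_apply, unitVec, Fin.ext_iff]
    rw [this]
    congr 1
    split_ifs <;> simp
  have h0 := coord_unitVec_self (k := k) (show 0 < n by omega)
  have h1 := coord_unitVec_self (k := k) (show 1 < n by omega)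
  refine mem_orbit_T02str hn (isAlt_T02str n α β) b ?_ ?_ ?_
  · simp only [hb, T02str_eq, wedgeStr_apply]
    simp [coord_unitVec_of_ne, h0, h1]
    module
  · intro j hj
    rw [hb, hb j, T02str_eq, wedgeStr_apply]
    generalize (if (j : ℕ) = 0 ∨ (j : ℕ) = 2 then c else 1) = d
    simp [coord_unitVec_of_ne (show 0 ≠ (j : ℕ) by omega),
      coord_unitVec_of_ne (show 1 ≠ (j : ℕ) by omega), h0]
    module
  · intro i j hi hj
    rw [hb i, hb j, T02str_eq, wedgeStr_apply]
    generalize (if (j : ℕ) = 0 ∨ (j : ℕ) = 2 then c else 1) = d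
    generalize (if (i : ℕ) = 0 ∨ (i : ℕ) = 2 then c else 1) = d'
    simp [coord_unitVec_of_ne (Ne.symm hi), coord_unitVec_of_ne (Ne.symm hj)]

theorem T02_three_swap (α β : k) : T02str 3 β α ∈ orbit (T02str 3 α β) := by
  have h0 := coord_unitVec_self (k := k) (show 0 < 3 by omega)
  have h1 := coord_unitVec_self (k := k) (show 1 < 3 by omega)
  have h2 := coord_unitVec_self (k := k) (show 2 < 3 by omega)
  have hli : LinearIndependent k
      ![(unitVec 3 0 : Fin 3 → k), unitVec 3 1, (α - β) • unitVec 3 1 + unitVec 3 2] := by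
    rw [Fintype.linearIndependent_iff]
    intro g hg
    have e0 := congrArg (coord k 3 0) hg
    have e1 := congrArg (coord k 3 1) hg
    have e2 := congrArg (coord k 3 2) hg
    simp [Fin.sum_univ_three, coord_unitVec_of_ne, h0, h1, h2] at e0 e1 e2
    rw [e2] at e1
    intro i
    fin_cases i
    · exact e0
    · simpa using e1
    · exact e2
  obtain ⟨b, hb⟩ := exists_basis_extend_top _ hli
  have b0 : b ⟨0, by omega⟩ = unitVec 3 0 := by
    rw [hb _ (by norm_num)]; rfl
  have b1 : b ⟨1, by omega⟩ = unitVec 3 1 := by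
    rw [hb _ (by norm_num)]; rfl
  have b2 : b ⟨2, by omega⟩ = (α - β) • unitVec 3 1 + unitVec 3 2 := by
    rw [hb _ (by norm_num)]; rfl
  refine mem_orbit_T02str le_rfl (isAlt_T02str 3 α β) b ?_ ?_ ?_
  · rw [b0, b1, b2, T02str_eq, wedgeStr_apply]
    simp [coord_unitVec_of_ne, h0, h1]
  · intro j hj
    rw [show j = ⟨2, by norm_num⟩ from Fin.ext (by simp only; omega), b0, b2, T02str_eq,
      wedgeStr_apply]
    simp [coord_unitVec_of_ne, h0, h1]
    module
  · have hz : ∀ i : Fin 3, (i : ℕ) ≠ 0 → coord k 3 0 (b i) = 0 := by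
      intro i hi
      rcases (show (i : ℕ) = 1 ∨ (i : ℕ) = 2 by omega) with h | h
      · rw [show i = ⟨1, by norm_num⟩ from Fin.ext h, b1, coord_unitVec_of_ne (by simp)]
      · rw [show i = ⟨2, by norm_num⟩ from Fin.ext h, b2]; simp [coord_unitVec_of_ne]
    intro i j hi hj
    rw [T02str_eq, wedgeStr_apply, hz i hi, hz j hj, zero_smul, zero_smul, sub_zero]

theorem T02_proportional {n : ℕ} (hn : 3 ≤ n) {α β α' β' : k} (h : (α, β) ≠ (0, 0))
    (h' : (α', β') ≠ (0, 0)) (heq : α * β' = β * α') :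
    T02str n α' β' ∈ orbit (T02str n α β) := by
  have : ∃ c : k, c ≠ 0 ∧ α' = c * α ∧ β' = c * β := by
    simp only [ne_eq, Prod.mk.injEq, not_and_or] at h h'
    by_cases hα : α = 0
    · have hβ : β ≠ 0 := by tauto
      have hα' : α' = 0 := by simpa [hα, hβ] using heq
      have hβ' : β' ≠ 0 := by tauto
      exact ⟨β' / β, div_ne_zero hβ' hβ, by simp [hα, hα'], by field_simp⟩
    · have hα' : α' ≠ 0 := by
        intro h0
        have : β' = 0 := by simpa [hα, h0] using heq
        tauto
      refine ⟨α' / α, div_ne_zero hα' hα, by field_simp, ?_⟩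
      field_simp
      linear_combination heq
  obtain ⟨c, hc, rfl, rfl⟩ := this
  exact T02_scale hn hc

theorem regFun_mul_const {n : ℕ} (φ : (Fin n → k) →ₗ[k] k) (a b : Fin n → k) :
    (fun ν : AlgStr k n => φ (ν a b)) ∈ regFun k n :=
  regFun_functional ((VecReg.const _).mul (VecReg.const _)) _

theorem regFun_mul_mul_const {n : ℕ} (φ : (Fin n → k) →ₗ[k] k) (a b c : Fin n → k) :
    (fun ν : AlgStr k n => φ (ν a (ν b c))) ∈ regFun k n :=
  regFun_functional ((VecReg.const _).mul ((VecReg.const _).mul (VecReg.const _))) _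

theorem T02_degenerates_T02 {n : ℕ} (hn : 4 ≤ n) {α β α' β' : k}
    (hd : degenerates (T02str n α β) (T02str n α' β')) : α * β' = β * α' := by
  have key : ∀ ν ∈ orbit (T02str n α β), ∀ (φ ψ : (Fin n → k) →ₗ[k] k) (x v u : Fin n → k),
      φ x = 0 → ψ x = 0 → φ v = 0 → ψ v = 0 → φ u = 0 →
      β * (φ (ν x (ν x v)) * ψ u) -
        (α + β) * (φ (ν x v) * ψ (ν x u) - ψ (ν x v) * φ (ν x u)) = 0 := by
    intro ν hν φ ψ x v u h1 h2 h3 h4 h5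
    obtain ⟨f, g, w, hf, hg, h⟩ := T02_form (by omega) hν
    simp only [h, map_add, map_smul, map_sub, h1, h2, h3, h4, h5, smul_eq_mul, hf, hg]
    ring
  have h1 := hd.eq_zero
    (r := fun ν => β * (coord k n 2 (ν (unitVec n 0) (ν (unitVec n 0) (unitVec n 1))) *
      coord k n 3 (unitVec n 3)) - (α + β) *
      (coord k n 2 (ν (unitVec n 0) (unitVec n 1)) * coord k n 3 (ν (unitVec n 0) (unitVec n 3)) -
      coord k n 3 (ν (unitVec n 0) (unitVec n 1)) * coord k n 2 (ν (unitVec n 0) (unitVec n 3))))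
    (regFun_sub (regFun_mul (regFun_const _) (regFun_mul (regFun_mul_mul_const _ _ _ _)
      (regFun_const _))) (regFun_mul (regFun_const _) (regFun_sub
      (regFun_mul (regFun_mul_const _ _ _) (regFun_mul_const _ _ _))
      (regFun_mul (regFun_mul_const _ _ _) (regFun_mul_const _ _ _)))))
    fun ν hν => key ν hν _ _ _ _ _ (coord_unitVec_of_ne (by simp)) (coord_unitVec_of_ne (by simp))
      (coord_unitVec_of_ne (by simp)) (coord_unitVec_of_ne (by simp))
      (coord_unitVec_of_ne (by simp))
  simp [T02str_eq, wedgeStr_apply, coord_unitVec_of_ne, coord_unitVec_self (show 1 < n by omega),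
    coord_unitVec_self (show 0 < n by omega), coord_unitVec_self (show 2 < n by omega),
    coord_unitVec_self (show 3 < n by omega)] at h1
  linear_combination -h1

theorem T02_degenerates_T02_three {α β α' β' : k}
    (hd : degenerates (T02str 3 α β) (T02str 3 α' β')) :
    (α * β' - β * α') * (α * α' - β * β') = 0 := by
  have key : ∀ ν ∈ orbit (T02str 3 α β), ∀ (φ ψ : (Fin 3 → k) →ₗ[k] k) (x v : Fin 3 → k),
      φ x = 0 → ψ x = 0 →
      (α + β) * (α + β) * ((φ (ν x v) * ψ (ν x (ν x v)) - ψ (ν x v) * φ (ν x (ν x v))) *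
        (φ v * ψ (ν x v) - ψ v * φ (ν x v))) -
      α * β * ((φ v * ψ (ν x (ν x v)) - ψ v * φ (ν x (ν x v))) *
        (φ v * ψ (ν x (ν x v)) - ψ v * φ (ν x (ν x v)))) = 0 := by
    intro ν hν φ ψ x v h1 h2
    obtain ⟨f, g, w, hf, hg, h⟩ := T02_form (by omega) hν
    simp only [h, map_add, map_smul, map_sub, h1, h2, smul_eq_mul, hf, hg]
    ring
  have h1 := hd.eq_zero
    (r := fun ν => (α + β) * (α + β) *
      ((coord k 3 1 (ν (unitVec 3 0) (unitVec 3 1)) *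
        coord k 3 2 (ν (unitVec 3 0) (ν (unitVec 3 0) (unitVec 3 1))) -
        coord k 3 2 (ν (unitVec 3 0) (unitVec 3 1)) *
        coord k 3 1 (ν (unitVec 3 0) (ν (unitVec 3 0) (unitVec 3 1)))) *
      (coord k 3 1 (unitVec 3 1) * coord k 3 2 (ν (unitVec 3 0) (unitVec 3 1)) -
        coord k 3 2 (unitVec 3 1) * coord k 3 1 (ν (unitVec 3 0) (unitVec 3 1)))) -
      α * β * ((coord k 3 1 (unitVec 3 1) *
        coord k 3 2 (ν (unitVec 3 0) (ν (unitVec 3 0) (unitVec 3 1))) -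
        coord k 3 2 (unitVec 3 1) *
        coord k 3 1 (ν (unitVec 3 0) (ν (unitVec 3 0) (unitVec 3 1)))) *
      (coord k 3 1 (unitVec 3 1) *
        coord k 3 2 (ν (unitVec 3 0) (ν (unitVec 3 0) (unitVec 3 1))) -
        coord k 3 2 (unitVec 3 1) *
        coord k 3 1 (ν (unitVec 3 0) (ν (unitVec 3 0) (unitVec 3 1))))))
    (by
      have hd : (fun ν : AlgStr k 3 => coord k 3 1 (unitVec 3 1) *
        coord k 3 2 (ν (unitVec 3 0) (ν (unitVec 3 0) (unitVec 3 1))) -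
        coord k 3 2 (unitVec 3 1) *
        coord k 3 1 (ν (unitVec 3 0) (ν (unitVec 3 0) (unitVec 3 1)))) ∈ regFun k 3 :=
        regFun_sub (regFun_mul (regFun_const _) (regFun_mul_mul_const _ _ _ _))
          (regFun_mul (regFun_const _) (regFun_mul_mul_const _ _ _ _))
      refine regFun_sub (regFun_mul (regFun_const _) (regFun_mul (regFun_sub
        (regFun_mul (regFun_mul_const _ _ _) (regFun_mul_mul_const _ _ _ _))
        (regFun_mul (regFun_mul_const _ _ _) (regFun_mul_mul_const _ _ _ _)))
        (regFun_sub (regFun_mul (regFun_const _) (regFun_mul_const _ _ _))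
          (regFun_mul (regFun_const _) (regFun_mul_const _ _ _)))))
        (regFun_mul (regFun_const _) (regFun_mul hd hd)))
    fun ν hν => key ν hν _ _ _ _ (coord_unitVec_of_ne (by simp)) (coord_unitVec_of_ne (by simp))
  simp [T02str_eq, wedgeStr_apply, coord_unitVec_of_ne,
    coord_unitVec_self (k := k) (show 1 < 3 by omega),
    coord_unitVec_self (k := k) (show 0 < 3 by omega),
    coord_unitVec_self (k := k) (show 2 < 3 by omega)] at h1
  linear_combination h1

theorem T02_mem_orbit_of_degenerates {n : ℕ} (hn : 3 ≤ n) {α β α' β' : k} (h : (α, β) ≠ (0, 0))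
    (h' : (α', β') ≠ (0, 0)) (hd : degenerates (T02str n α β) (T02str n α' β')) :
    T02str n α' β' ∈ orbit (T02str n α β) := by
  rcases hn.eq_or_lt with rfl | hn'
  · rcases mul_eq_zero.1 (T02_degenerates_T02_three hd) with h0 | h0
    · exact T02_proportional le_rfl h h' (sub_eq_zero.1 h0)
    · refine mem_orbit_trans (T02_proportional le_rfl h (α' := β') (β' := α') ?_
        (sub_eq_zero.1 h0)) (T02_three_swap _ _)
      simp only [ne_eq, Prod.mk.injEq] at h' ⊢
      tauto
  · exact T02_proportional hn h h' (T02_degenerates_T02 hn' hd)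

/-! ### Orbits are open in their closures -/

theorem exists_polynomial_image [IsAlgClosed k] {σ τ : Type*} [Finite σ] [Finite τ]
    (F : σ → MvPolynomial τ k) (d : MvPolynomial τ k) (hd : d ≠ 0) :
    ∃ f : MvPolynomial σ k, MvPolynomial.aeval F f ≠ 0 ∧ ∀ x : σ → k,
      (∀ p, MvPolynomial.aeval F p = 0 → MvPolynomial.eval x p = 0) → MvPolynomial.eval x f ≠ 0 →
        ∃ h : τ → k, MvPolynomial.eval h d ≠ 0 ∧ ∀ s, MvPolynomial.eval h (F s) = x s := by
  classical
  set φ : MvPolynomial σ k →ₐ[k] MvPolynomial τ k := MvPolynomial.aeval F with hφ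
  have hfp : φ.toRingHom.FinitePresentation := by
    refine RingHom.FinitePresentation.of_comp_finiteType (algebraMap k (MvPolynomial σ k)) ?_ ?_
    · rw [show φ.toRingHom.comp (algebraMap k (MvPolynomial σ k)) =
        algebraMap k (MvPolynomial τ k) from φ.comp_algebraMap]
      exact RingHom.finitePresentation_algebraMap.2 inferInstance
    · exact RingHom.finiteType_algebraMap.2 inferInstance
  obtain ⟨S, hS⟩ := PrimeSpectrum.exists_constructibleSetData_iff.2
    (PrimeSpectrum.isConstructible_comap_image hfp
      (PrimeSpectrum.isConstructible_basicOpen (f := d)))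
  have hbot : PrimeSpectrum.comap φ.toRingHom ⟨⊥, Ideal.isPrime_bot⟩ ∈
      PrimeSpectrum.ConstructibleSetData.toSet S := by
    rw [hS]
    exact ⟨_, by simpa [PrimeSpectrum.mem_basicOpen] using hd, rfl⟩
  simp only [PrimeSpectrum.ConstructibleSetData.toSet, Set.mem_iUnion] at hbot
  obtain ⟨C, hC, hmem⟩ := hbot
  have hg : ∀ i, φ (C.g i) = 0 := fun i => by
    have := hmem.1 (Set.mem_range_self i)
    simpa using this
  have hf : φ C.f ≠ 0 := fun h0 => hmem.2 (by
    rw [PrimeSpectrum.mem_zeroLocus, Set.singleton_subset_iff]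
    simpa using h0)
  refine ⟨C.f, hf, fun x hx hxf => ?_⟩
  have hxmem : (⟨MvPolynomial.vanishingIdeal k {x}, inferInstance⟩ :
      PrimeSpectrum (MvPolynomial σ k)) ∈ PrimeSpectrum.ConstructibleSetData.toSet S := by
    simp only [PrimeSpectrum.ConstructibleSetData.toSet, Set.mem_iUnion]
    refine ⟨C, hC, ?_, ?_⟩
    · rw [PrimeSpectrum.mem_zeroLocus]
      rintro _ ⟨i, rfl⟩
      rw [SetLike.mem_coe, MvPolynomial.mem_vanishingIdeal_singleton_iff]
      simpa [MvPolynomial.aeval_eq_eval] using hx _ (hg i)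
    · rw [PrimeSpectrum.mem_zeroLocus, Set.singleton_subset_iff, SetLike.mem_coe,
        MvPolynomial.mem_vanishingIdeal_singleton_iff]
      simpa [MvPolynomial.aeval_eq_eval] using hxf
  rw [hS] at hxmem
  obtain ⟨Q, hQd, hQ⟩ := hxmem
  have hcomap : Q.asIdeal.comap φ.toRingHom = MvPolynomial.vanishingIdeal k {x} :=
    congrArg PrimeSpectrum.asIdeal hQ
  have hdQ : d ∉ Q.asIdeal := hQd
  have := Q.2
  rw [← MvPolynomial.IsPrime.vanishingIdeal_zeroLocus (K := k) Q.asIdeal,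
    MvPolynomial.mem_vanishingIdeal_iff] at hdQ
  push Not at hdQ
  obtain ⟨h, hh, hhd⟩ := hdQ
  refine ⟨h, by simpa [MvPolynomial.aeval_eq_eval] using hhd, fun s => ?_⟩
  have hs : (MvPolynomial.X s - MvPolynomial.C (x s) : MvPolynomial σ k) ∈
      Q.asIdeal.comap φ.toRingHom := by
    rw [hcomap, MvPolynomial.mem_vanishingIdeal_singleton_iff]
    simp
  have h2 := hh _ (Ideal.mem_comap.1 hs)
  simpa [hφ, sub_eq_zero, MvPolynomial.aeval_eq_eval] using h2

/-- The structure `(x, y) ↦ adj(H) (μ (H x) (H y))`, which depends polynomially on `H`. -/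
def adjTransport {n : ℕ} (μ : AlgStr k n) (H : Matrix (Fin n) (Fin n) k) : AlgStr k n :=
  ((μ.comp H.toLin').compl₂ H.toLin').compr₂ H.adjugate.toLin'

theorem adjTransport_apply {n : ℕ} (μ : AlgStr k n) (H : Matrix (Fin n) (Fin n) k)
    (x y : Fin n → k) :
    adjTransport μ H x y = H.adjugate.mulVec (μ (H.mulVec x) (H.mulVec y)) := by
  simp [adjTransport]

theorem structConst_adjTransport {n : ℕ} (μ : AlgStr k n) (H : Matrix (Fin n) (Fin n) k)
    (t : Fin n × Fin n × Fin n) :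
    structConst (adjTransport μ H) t = ∑ a, H.adjugate t.2.2 a *
      ∑ b, ∑ c, H b t.1 * H c t.2.1 * structConst μ (b, c, a) := by
  rw [structConst, adjTransport_apply, Matrix.mulVec, dotProduct]
  simp only [algStr_apply_coord μ, Matrix.mulVec_single_one, Matrix.col_apply]

theorem adjTransport_mem_orbit {n : ℕ} (μ : AlgStr k n) {H : Matrix (Fin n) (Fin n) k}
    (hH : H.det ≠ 0) : adjTransport μ H ∈ orbit μ := by
  have h1 : (H.det⁻¹ ^ 2 • H.adjugate) * (H.det • H) = 1 := by
    rw [smul_mul_assoc, mul_smul_comm, Matrix.adjugate_mul, smul_smul, smul_smul]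
    rw [show H.det⁻¹ ^ 2 * H.det * H.det = 1 by field_simp, one_smul]
  have h2 : (H.det • H) * (H.det⁻¹ ^ 2 • H.adjugate) = 1 := mul_eq_one_comm.1 h1
  refine ⟨LinearEquiv.ofLinearMap (Matrix.toLin' (H.det⁻¹ ^ 2 • H.adjugate))
    (Matrix.toLin' (H.det • H)) ?_ ?_, ?_⟩
  · rw [← Matrix.toLin'_mul, h1, Matrix.toLin'_one]
  · rw [← Matrix.toLin'_mul, h2, Matrix.toLin'_one]
  · refine LinearMap.ext fun x => LinearMap.ext fun y => ?_
    rw [transport_apply, adjTransport_apply]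
    simp only [LinearEquiv.symm_ofLinearMap, LinearEquiv.coe_ofLinearMap, Matrix.toLin'_apply,
      map_smul, LinearMap.smul_apply, smul_smul]
    rw [show H.det * H.det * H.det⁻¹ ^ 2 = 1 by field_simp, one_smul]

theorem exists_adjTransport_eq [IsAlgClosed k] {n : ℕ} {μ ν : AlgStr k n} (h : ν ∈ orbit μ) :
    ∃ H : Matrix (Fin n) (Fin n) k, H.det ≠ 0 ∧ adjTransport μ H = ν := by
  rcases Nat.eq_zero_or_pos n with rfl | hn
  · exact ⟨1, by simp, Subsingleton.elim _ _⟩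
  obtain ⟨g, rfl⟩ := h
  set A := LinearMap.toMatrix' g.toLinearMap
  set G := LinearMap.toMatrix' g.symm.toLinearMap
  have hAG : A * G = 1 := by
    rw [← LinearMap.toMatrix'_comp]; simp
  have hGA : G * A = 1 := mul_eq_one_comm.1 hAG
  have hd : G.det ≠ 0 := fun h0 => by
    have := congrArg Matrix.det hGA
    rw [Matrix.det_mul, h0] at this
    simp at this
  have hadj : G.adjugate = G.det • A := by
    calc G.adjugate = G.adjugate * (G * A) := by rw [hGA, mul_one]
      _ = G.det • A := by rw [← mul_assoc, Matrix.adjugate_mul, smul_mul_assoc, one_mul]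
  obtain ⟨c, hc⟩ := IsAlgClosed.exists_pow_nat_eq (G.det⁻¹) (n := n + 1) (by omega)
  have hc0 : c ≠ 0 := by
    rintro rfl
    rw [zero_pow (by omega)] at hc
    exact inv_ne_zero hd hc.symm
  refine ⟨c • G, ?_, ?_⟩
  · rw [Matrix.det_smul]
    exact mul_ne_zero (pow_ne_zero _ hc0) hd
  · refine LinearMap.ext fun x => LinearMap.ext fun y => ?_
    have hG : ∀ z, G.mulVec z = g.symm z := fun z => by
      rw [← Matrix.toLin'_apply, Matrix.toLin'_toMatrix']; rfl
    have hA : ∀ z, A.mulVec z = g z := fun z => by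
      rw [← Matrix.toLin'_apply, Matrix.toLin'_toMatrix']; rfl
    rw [adjTransport_apply, transport_apply, Matrix.adjugate_smul, hadj, Fintype.card_fin]
    simp only [Matrix.smul_mulVec, map_smul, LinearMap.smul_apply, Matrix.mulVec_smul, hG, hA,
      smul_smul]
    rw [show c * c * (c ^ (n - 1) * G.det) = 1 by
      rw [show c * c * (c ^ (n - 1) * G.det) = c ^ (n - 1 + 2) * G.det by ring,
        show n - 1 + 2 = n + 1 by omega, hc, inv_mul_cancel₀ hd], one_smul]

/-- The structure constants of the universal `adjTransport`. -/
def adjPoly {n : ℕ} (μ : AlgStr k n) (t : Fin n × Fin n × Fin n) :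
    MvPolynomial (Fin n × Fin n) k :=
  ∑ a, (Matrix.mvPolynomialX (Fin n) (Fin n) k).adjugate t.2.2 a *
    ∑ b, ∑ c, MvPolynomial.X (b, t.1) * MvPolynomial.X (c, t.2.1) *
      MvPolynomial.C (structConst μ (b, c, a))

theorem eval_adjPoly {n : ℕ} (μ : AlgStr k n) (H : Matrix (Fin n) (Fin n) k)
    (t : Fin n × Fin n × Fin n) :
    MvPolynomial.eval (fun p => H p.1 p.2) (adjPoly μ t) =
      structConst (adjTransport μ H) t := by
  have h := RingHom.map_adjugate (MvPolynomial.eval fun p : Fin n × Fin n => H p.1 p.2)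
    (Matrix.mvPolynomialX (Fin n) (Fin n) k)
  rw [Matrix.mvPolynomialX_mapMatrix_eval] at h
  have h' : ∀ a, MvPolynomial.eval (fun p : Fin n × Fin n => H p.1 p.2)
      ((Matrix.mvPolynomialX (Fin n) (Fin n) k).adjugate t.2.2 a) = H.adjugate t.2.2 a := fun a =>
    congrFun (congrFun h t.2.2) a
  rw [structConst_adjTransport, adjPoly]
  simp only [map_sum, map_mul, h', MvPolynomial.eval_X, MvPolynomial.eval_C]

theorem eval_det_mvPolynomialX {n : ℕ} (H : Matrix (Fin n) (Fin n) k) :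
    MvPolynomial.eval (fun p => H p.1 p.2) (Matrix.mvPolynomialX (Fin n) (Fin n) k).det =
      H.det := by
  rw [RingHom.map_det, Matrix.mvPolynomialX_mapMatrix_eval]

theorem eval_aeval_adjPoly {n : ℕ} (μ : AlgStr k n) (H : Matrix (Fin n) (Fin n) k)
    (p : MvPolynomial (Fin n × Fin n × Fin n) k) :
    MvPolynomial.eval (fun q => H q.1 q.2) (MvPolynomial.aeval (adjPoly μ) p) =
      MvPolynomial.eval (structConst (adjTransport μ H)) p := by
  induction p using MvPolynomial.induction_on with
  | C a => simp
  | add p q hp hq => simp only [map_add, hp, hq]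
  | mul_X p i hp => simp only [map_mul, hp, MvPolynomial.aeval_X, MvPolynomial.eval_X, eval_adjPoly]

/-- The orbit is open in its closure. -/
theorem exists_regFun_of_orbit [IsAlgClosed k] {n : ℕ} (μ : AlgStr k n) :
    ∃ r ∈ regFun k n, (∃ ν ∈ orbit μ, r ν ≠ 0) ∧
      ∀ χ, degenerates μ χ → r χ ≠ 0 → χ ∈ orbit μ := by
  have hd := Matrix.det_mvPolynomialX_ne_zero (Fin n) k
  obtain ⟨f, hf, H⟩ := exists_polynomial_image (adjPoly μ) _ hd
  refine ⟨fun ν => MvPolynomial.eval (structConst ν) f, mem_regFun.2 ⟨f, fun _ => rfl⟩, ?_, ?_⟩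
  · have : ∃ x : Fin n × Fin n → k, MvPolynomial.eval x (MvPolynomial.aeval (adjPoly μ) f *
        (Matrix.mvPolynomialX (Fin n) (Fin n) k).det) ≠ 0 := by
      by_contra! hall
      exact mul_ne_zero hf hd (MvPolynomial.funext fun x => by rw [hall x, map_zero])
    obtain ⟨x, hx⟩ := this
    rw [map_mul] at hx
    have e1 := eval_aeval_adjPoly μ (Matrix.of fun i j => x (i, j)) f
    have e2 := eval_det_mvPolynomialX (Matrix.of fun i j => x (i, j))
    simp only [Matrix.of_apply, Prod.mk.eta] at e1 e2
    refine ⟨_, adjTransport_mem_orbit μ (H := Matrix.of fun i j => x (i, j)) ?_, ?_⟩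
    · rw [← e2]; exact right_ne_zero_of_mul hx
    · beta_reduce; rw [← e1]; exact left_ne_zero_of_mul hx
  · intro χ hχ hfχ
    obtain ⟨h, hh, hF⟩ := H (structConst χ) (fun p hp => by
      refine degenerates_iff.1 hχ _ (mem_regFun.2 ⟨p, fun _ => rfl⟩) fun ν hν => ?_
      obtain ⟨G, -, rfl⟩ := exists_adjTransport_eq hν
      rw [← eval_aeval_adjPoly, hp, map_zero]) hfχ
    have e2 := eval_det_mvPolynomialX (Matrix.of fun i j => h (i, j))
    have e3 := eval_adjPoly μ (Matrix.of fun i j => h (i, j))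
    simp only [Matrix.of_apply, Prod.mk.eta] at e2 e3
    have : χ = adjTransport μ (Matrix.of fun i j => h (i, j)) :=
      algStr_ext fun i j m => by rw [← hF, e3]
    rw [this]
    exact adjTransport_mem_orbit μ (by rw [← e2]; exact hh)

theorem mem_orbit_of_degenerates_of_degenerates [IsAlgClosed k] {n : ℕ} {μ χ : AlgStr k n}
    (h : degenerates μ χ) (h' : degenerates χ μ) : χ ∈ orbit μ := by
  obtain ⟨r, hr, ⟨ν, hν, hrν⟩, H⟩ := exists_regFun_of_orbit μ
  have : ∃ ψ ∈ orbit χ, r ψ ≠ 0 := by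
    by_contra! h0
    exact hrν (degenerates_iff.1 (h'.trans (degenerates_of_mem_orbit hν)) r hr h0)
  obtain ⟨ψ, hψ, hrψ⟩ := this
  exact mem_orbit_trans (H ψ (h.trans (degenerates_of_mem_orbit hψ)) hrψ) (mem_orbit_symm hψ)

/-! ### Endomorphisms that are scalar up to rank one -/

section Endomorphism

open Submodule

variable {Q U : Type*} [AddCommGroup Q] [Module k Q] [AddCommGroup U] [Module k U]

theorem linearIndependent_pair_of_mkQ {W : Submodule k Q} {u w z₁ z₂ : Q} (hu : u ∈ W)
    (hw : w ∈ W) (h₁ : LinearIndependent k ![u, w])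
    (h₂ : LinearIndependent k ![W.mkQ z₁, W.mkQ z₂]) :
    LinearIndependent k ![u, w, z₁, z₂] := by
  rw [LinearIndependent.pair_iff] at h₁ h₂
  rw [Fintype.linearIndependent_iff]
  intro g hg
  simp only [Fin.sum_univ_four, Matrix.cons_val] at hg
  have hq := congrArg W.mkQ hg
  simp only [map_add, map_smul, map_zero, (mkQ_apply W u).trans ((Quotient.mk_eq_zero W).2 hu),
    (mkQ_apply W w).trans ((Quotient.mk_eq_zero W).2 hw), smul_zero, zero_add] at hq
  obtain ⟨h3, h4⟩ := h₂ _ _ hq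
  rw [h3, h4, zero_smul, zero_smul, add_zero, add_zero] at hg
  obtain ⟨h5, h6⟩ := h₁ _ _ hg
  intro i
  fin_cases i <;> assumption

theorem linearIndependent_three_of_notMem {W : Submodule k Q} {u w z : Q} (hu : u ∈ W)
    (hw : w ∈ W) (h₁ : LinearIndependent k ![u, w]) (h₂ : z ∉ W) :
    LinearIndependent k ![u, w, z] := by
  rw [LinearIndependent.pair_iff] at h₁
  rw [Fintype.linearIndependent_iff]
  intro g hg
  simp only [Fin.sum_univ_three, Matrix.cons_val] at hg
  have h3 : g 2 = 0 := by
    by_contra h0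
    refine h₂ ((W.smul_mem_iff h0).1 ?_)
    rw [← neg_eq_of_add_eq_zero_right hg]
    exact W.neg_mem (W.add_mem (W.smul_mem _ hu) (W.smul_mem _ hw))
  rw [h3, zero_smul, add_zero] at hg
  obtain ⟨h5, h6⟩ := h₁ _ _ hg
  intro i
  fin_cases i <;> assumption

/-- A linear map that is pointwise proportional to a surjection of rank at least two is a
multiple of it. -/
theorem exists_eq_smul_of_forall_not_linearIndependent [Module.Finite k U] (A B : Q →ₗ[k] U)
    (hA : Function.Surjective A) (hU : 2 ≤ Module.finrank k U)
    (h : ∀ v, ¬LinearIndependent k ![A v, B v]) : ∃ β : k, ∀ v, B v = β • A v := by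
  have hmul : ∀ v, A v ≠ 0 → ∃ c : k, B v = c • A v := fun v hv => by
    have := h v
    rw [LinearIndependent.pair_iff' hv] at this
    push Not at this
    obtain ⟨c, hc⟩ := this
    exact ⟨c, hc.symm⟩
  have hker : ∀ w, A w = 0 → B w = 0 := by
    intro w hw
    have hw' : ∀ v, A v ≠ 0 → ∃ c : k, B w = c • A v := by
      intro v hv
      obtain ⟨c, hc⟩ := hmul v hv
      obtain ⟨d, hd⟩ := hmul (v + w) (by rwa [map_add, hw, add_zero])
      refine ⟨d - c, ?_⟩
      rw [map_add, map_add, hw, add_zero, hc] at hd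
      rw [sub_smul, ← hd, add_sub_cancel_left]
    let b := Module.finBasis k U
    have hli : LinearIndependent k ![b ⟨0, by omega⟩, b ⟨1, by omega⟩] := by
      have := b.linearIndependent.comp (![⟨0, by omega⟩, ⟨1, by omega⟩] :
        Fin 2 → Fin (Module.finrank k U)) (by
          intro i j hij
          fin_cases i <;> fin_cases j <;> simp_all)
      convert this using 1
      ext i; fin_cases i <;> rfl
    obtain ⟨v₀, h0⟩ := hA (b ⟨0, by omega⟩)
    obtain ⟨v₁, h1⟩ := hA (b ⟨1, by omega⟩)
    obtain ⟨c, hc⟩ := hw' v₀ (by rw [h0]; exact b.ne_zero _)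
    obtain ⟨d, hd⟩ := hw' v₁ (by rw [h1]; exact b.ne_zero _)
    rw [h0] at hc
    rw [h1] at hd
    rw [LinearIndependent.pair_iff] at hli
    have := (hli c (-d) (by rw [neg_smul, ← hc, ← hd, add_neg_cancel])).1
    rw [hc, this, zero_smul]
  obtain ⟨s, hs⟩ := A.exists_rightInverse_of_surjective (LinearMap.range_eq_top.2 hA)
  have hs' : ∀ u, A (s u) = u := fun u => LinearMap.congr_fun hs u
  obtain ⟨β, hβ⟩ := LinearMap.exists_eq_smul_id_of_forall_notLinearIndependent (f := B.comp s)
    (fun v => by simpa [hs'] using h (s v))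
  refine ⟨β, fun v => ?_⟩
  have h1 : B (v - s (A v)) = 0 := hker _ (by rw [map_sub, hs', sub_self])
  rw [map_sub, sub_eq_zero] at h1
  rw [h1]
  simpa using LinearMap.congr_fun hβ (A v)

theorem linearIndependent_add_smul_of_four {a b c d : Q} (β : k)
    (h : LinearIndependent k ![a, b, c, d]) :
    LinearIndependent k ![c, a + β • c, d, b + β • d] := by
  rw [Fintype.linearIndependent_iff] at h ⊢
  intro g hg
  simp only [Fin.sum_univ_four, Matrix.cons_val] at hg
  have := h ![g 1, g 3, g 0 + β * g 1, g 2 + β * g 3] (by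
    simp only [Fin.sum_univ_four, Matrix.cons_val]
    rw [← hg]; module)
  have h0 := this 0
  have h1 := this 1
  have h2 := this 2
  have h3 := this 3
  simp only [Matrix.cons_val] at h0 h1 h2 h3
  rw [h0, mul_zero, add_zero] at h2
  rw [h1, mul_zero, add_zero] at h3
  intro i
  fin_cases i <;> assumption

theorem linearIndependent_add_smul_of_three {a b c : Q} (β : k)
    (h : LinearIndependent k ![a, b, c]) :
    LinearIndependent k ![c, a + β • c, b + β • a + β • (a + β • c)] := by
  rw [Fintype.linearIndependent_iff] at h ⊢
  intro g hg
  simp only [Fin.sum_univ_three, Matrix.cons_val] at hg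
  have := h ![g 1 + 2 * β * g 2, g 2, g 0 + β * g 1 + β * β * g 2] (by
    simp only [Fin.sum_univ_three, Matrix.cons_val]
    rw [← hg]; module)
  have h0 := this 0
  have h1 := this 1
  have h2 := this 2
  simp only [Matrix.cons_val] at h0 h1 h2
  rw [h1, mul_zero, add_zero] at h0
  rw [h1, h0, mul_zero, mul_zero, add_zero, add_zero] at h2
  intro i
  fin_cases i <;> assumption

theorem linearIndependent_smul_add {u w : Q} (h : LinearIndependent k ![u, w]) {r : k}
    (hr : r ≠ 0) (s : k) : LinearIndependent k ![r • u, s • u + w] := by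
  rw [LinearIndependent.pair_iff] at h ⊢
  intro a b hab
  obtain ⟨h1, h2⟩ := h (a * r + b * s) b (by rw [← hab]; module)
  subst h2
  rw [zero_mul, add_zero] at h1
  exact ⟨(mul_eq_zero.1 h1).resolve_right hr, rfl⟩

/-- If every vector outside a proper subspace is mapped into a line up to a scalar, then so is
every vector. -/
theorem forall_exists_of_forall_notMem {W : Submodule k Q} (hW : W ≠ ⊤) {M : Q →ₗ[k] Q} {β : k}
    {w : Q} (h : ∀ z ∉ W, ∃ c : k, M z = β • z + c • w) (z : Q) :
    ∃ c : k, M z = β • z + c • w := by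
  by_cases hz : z ∈ W
  · obtain ⟨y, hy⟩ : ∃ y, y ∉ W := by
      by_contra! hall
      exact hW (eq_top_iff.2 fun y _ => hall y)
    obtain ⟨c, hc⟩ := h y hy
    obtain ⟨d, hd⟩ := h (z + y) (fun hzy => hy ((W.add_mem_iff_right hz).1 hzy))
    refine ⟨d - c, ?_⟩
    rw [map_add, hc] at hd
    rw [eq_sub_of_add_eq hd]; module
  · exact h z hz

theorem linearIndependent_apply_sub {M : Q →ₗ[k] Q} {u : Q} (h : LinearIndependent k ![u, M u])
    (β : k) : LinearIndependent k ![u, M u - β • u] := by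
  rw [LinearIndependent.pair_iff] at h ⊢
  intro a b hab
  obtain ⟨h1, h2⟩ := h (a - b * β) b (by rw [← hab]; module)
  subst h2
  simpa using h1

theorem exists_scalar_add_rank_one_of_four_le [Module.Finite k Q] (hQ : 4 ≤ Module.finrank k Q)
    (M : Q →ₗ[k] Q) (h : ∀ u v, ¬LinearIndependent k ![u, M u, v, M v]) :
    ∃ (β : k) (w : Q), ∀ z, ∃ c : k, M z = β • z + c • w := by
  by_cases hs : ∀ u, ¬LinearIndependent k ![u, M u]
  · obtain ⟨β, hβ⟩ := LinearMap.exists_eq_smul_id_of_forall_notLinearIndependent hs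
    exact ⟨β, 0, fun z => ⟨0, by simp [hβ]⟩⟩
  push Not at hs
  obtain ⟨u, hu⟩ := hs
  set W : Submodule k Q := span k (Set.range ![u, M u]) with hW
  have hWf : Module.finrank k W = 2 := by
    rw [hW, finrank_span_eq_card hu, Fintype.card_fin]
  have hU : 2 ≤ Module.finrank k (Q ⧸ W) := by
    have := W.finrank_quotient_add_finrank
    omega
  have huW : u ∈ W := subset_span ⟨0, rfl⟩
  have hMuW : M u ∈ W := subset_span ⟨1, rfl⟩
  obtain ⟨β, hβ⟩ := exists_eq_smul_of_forall_not_linearIndependent W.mkQ (W.mkQ.comp M)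
    W.mkQ_surjective hU fun z hz => h u z (linearIndependent_pair_of_mkQ huW hMuW hu hz)
  set w := M u - β • u with hw
  have hwW : w ∈ W := W.sub_mem hMuW (W.smul_mem _ huW)
  have huw : LinearIndependent k ![u, w] := linearIndependent_apply_sub hu β
  have hform : ∀ z, ∃ r s : k, M z = β • z + r • u + s • w := by
    intro z
    have h1 : M z - β • z ∈ W := by
      rw [← Quotient.mk_eq_zero, ← mkQ_apply, map_sub, map_smul, sub_eq_zero]
      exact hβ z
    rw [hW, Matrix.range_cons_cons_empty, mem_span_pair] at h1
    obtain ⟨a, b, hab⟩ := h1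
    refine ⟨a + b * β, b, ?_⟩
    rw [eq_add_of_sub_eq' hab.symm, hw]; module
  refine ⟨β, w, forall_exists_of_forall_notMem (W := W) (fun ht => ?_) fun z₁ hz₁ => ?_⟩
  · rw [ht, finrank_top] at hWf
    omega
  · have hz0 : W.mkQ z₁ ≠ 0 := fun h0 => hz₁ ((Quotient.mk_eq_zero W).1 h0)
    obtain ⟨z₂', hz₂⟩ := exists_linearIndependent_pair_of_one_lt_finrank (R := k)
      (Nat.lt_of_succ_le hU) hz0
    obtain ⟨z₂, rfl⟩ := W.mkQ_surjective z₂'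
    obtain ⟨r₁, s₁, e₁⟩ := hform z₁
    obtain ⟨r₂, s₂, e₂⟩ := hform z₂
    by_cases hr : r₁ = 0
    · exact ⟨s₁, by rw [e₁, hr]; module⟩
    exfalso
    have hmk : ∀ c : k, W.mkQ (c • u) = 0 := fun c =>
      (Quotient.mk_eq_zero W).2 (W.smul_mem _ huW)
    have key := linearIndependent_add_smul_of_four β (linearIndependent_pair_of_mkQ
      (z₁ := z₁ - s₁ • u) (z₂ := z₂ + (1 - s₂) • u)
      (W.smul_mem r₁ huW) (W.add_mem (W.smul_mem r₂ huW) hwW)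
      (linearIndependent_smul_add huw hr r₂)
      (by rw [map_sub, map_add, hmk, hmk, sub_zero, add_zero]; exact hz₂))
    have hMu : M u = w + β • u := by rw [hw]; module
    refine h (z₁ - s₁ • u) (z₂ + (1 - s₂) • u) ?_
    convert key using 4
    · rw [map_sub, map_smul, e₁, hMu]; module
    · congr 1
      rw [map_add, map_smul, e₂, hMu]; module

theorem exists_scalar_add_rank_one_of_three [Module.Finite k Q] (hQ : Module.finrank k Q = 3)
    (M : Q →ₗ[k] Q) (h : ∀ v, ¬LinearIndependent k ![v, M v, M (M v)]) :
    ∃ (β : k) (w : Q), ∀ z, ∃ c : k, M z = β • z + c • w := by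
  by_cases hs : ∀ u, ¬LinearIndependent k ![u, M u]
  · obtain ⟨β, hβ⟩ := LinearMap.exists_eq_smul_id_of_forall_notLinearIndependent hs
    exact ⟨β, 0, fun z => ⟨0, by simp [hβ]⟩⟩
  push Not at hs
  obtain ⟨u, hu⟩ := hs
  set W : Submodule k Q := span k (Set.range ![u, M u]) with hW
  have hWf : Module.finrank k W = 2 := by
    rw [hW, finrank_span_eq_card hu, Fintype.card_fin]
  have hU : Module.finrank k (Q ⧸ W) = 1 := by
    have := W.finrank_quotient_add_finrank
    omega
  have huW : u ∈ W := subset_span ⟨0, rfl⟩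
  have hMuW : M u ∈ W := subset_span ⟨1, rfl⟩
  have hMMuW : M (M u) ∈ W := by
    by_contra hn
    exact h u (linearIndependent_three_of_notMem huW hMuW hu hn)
  have hinv : W ≤ W.comap M := by
    conv_lhs => rw [hW, Matrix.range_cons_cons_empty]
    rw [span_le, Set.insert_subset_iff, Set.singleton_subset_iff]
    exact ⟨hMuW, hMMuW⟩
  obtain ⟨β, hβ'⟩ : ∃ β : k, W.mapQ W M hinv = β • LinearMap.id := by
    obtain ⟨e, he, hspan⟩ := finrank_eq_one_iff'.1 hU
    obtain ⟨β, hβ⟩ := hspan (W.mapQ W M hinv e)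
    refine ⟨β, LinearMap.ext fun v => ?_⟩
    obtain ⟨c, rfl⟩ := hspan v
    rw [map_smul, ← hβ, LinearMap.smul_apply, LinearMap.id_apply, smul_comm]
  have hβ : ∀ z, W.mkQ (M z) = β • W.mkQ z := fun z => by
    simpa using LinearMap.congr_fun hβ' (W.mkQ z)
  set w := M u - β • u with hw
  have hwW : w ∈ W := W.sub_mem hMuW (W.smul_mem _ huW)
  have huw : LinearIndependent k ![u, w] := linearIndependent_apply_sub hu β
  refine ⟨β, w, forall_exists_of_forall_notMem (W := W) (fun ht => ?_) fun z hz => ?_⟩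
  · rw [ht, finrank_top] at hWf
    omega
  · have h1 : M z - β • z ∈ W := by
      rw [← Quotient.mk_eq_zero, ← mkQ_apply, map_sub, map_smul, sub_eq_zero]
      exact hβ z
    rw [hW, Matrix.range_cons_cons_empty, mem_span_pair] at h1
    obtain ⟨a, b, hab⟩ := h1
    have e : M z = β • z + (a + b * β) • u + b • w := by
      rw [eq_add_of_sub_eq' hab.symm, hw]; module
    by_cases hr : a + b * β = 0
    · exact ⟨b, by rw [e, hr]; module⟩
    exfalso
    set r := a + b * β
    have hli : LinearIndependent k ![r • u, r • w] := by
      rw [LinearIndependent.pair_iff] at huw ⊢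
      intro c d hcd
      obtain ⟨h1, h2⟩ := huw (c * r) (d * r) (by rw [← hcd]; module)
      exact ⟨(mul_eq_zero.1 h1).resolve_right hr, (mul_eq_zero.1 h2).resolve_right hr⟩
    have key := linearIndependent_add_smul_of_three β (linearIndependent_three_of_notMem
      (z := z - b • u) (W.smul_mem r huW) (W.smul_mem r hwW) hli
      (fun hm => hz ((W.sub_mem_iff_left (W.smul_mem _ huW)).1 hm)))
    have hMu : M u = w + β • u := by rw [hw]; module
    have hMz : M (z - b • u) = r • u + β • (z - b • u) := by
      rw [map_sub, map_smul, e, hMu]; module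
    refine h (z - b • u) ?_
    convert key using 4
    · rw [hMz, map_add, map_smul, map_smul, hMz, hMu]; module

theorem exists_scalar_add_rank_one_of_two [IsAlgClosed k] [Module.Finite k Q]
    (hQ : Module.finrank k Q = 2) (M : Q →ₗ[k] Q) :
    ∃ (β : k) (w : Q), ∀ z, ∃ c : k, M z = β • z + c • w := by
  have : Nontrivial Q := Module.nontrivial_of_finrank_pos (R := k) (by omega)
  obtain ⟨β, hβ⟩ := Module.End.exists_eigenvalue (K := k) M
  set A : Q →ₗ[k] Q := M - β • LinearMap.id with hA
  have hker : 1 ≤ Module.finrank k (LinearMap.ker A) := by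
    obtain ⟨v, hv⟩ := hβ.exists_hasEigenvector
    rw [Nat.one_le_iff_ne_zero, Ne, finrank_eq_zero, Submodule.eq_bot_iff]
    exact fun h => hv.2 (h v (by simp [hA, hv.apply_eq_smul]))
  have hrange : Module.finrank k (LinearMap.range A) ≤ 1 := by
    have := A.finrank_range_add_finrank_ker
    omega
  obtain ⟨w, hw⟩ := finrank_le_one_iff.1 hrange
  refine ⟨β, w, fun z => ?_⟩
  obtain ⟨c, hc⟩ := hw ⟨A z, z, rfl⟩
  refine ⟨c, ?_⟩
  have : c • (w : Q) = M z - β • z := by simpa [hA] using congrArg Subtype.val hc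
  rw [this]; module

end Endomorphism

/-! ### Left multiplications modulo a line -/

section LeftMultiplication

open Submodule

theorem linearIndependent_cons_of_mkQ {V : Type*} [AddCommGroup V] [Module k V] {x : V}
    (hx : x ≠ 0) {m : ℕ} {v : Fin m → V} {w : Fin m → V ⧸ span k {x}}
    (hw : ∀ i, (span k {x}).mkQ (v i) = w i) (h : LinearIndependent k w) :
    LinearIndependent k (Matrix.vecCons x v) := by
  rw [Fintype.linearIndependent_iff] at h ⊢
  intro g hg
  simp only [Fin.sum_univ_succ, Matrix.cons_val_zero, Matrix.cons_val_succ] at hg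
  have h1 : ∀ i : Fin m, g i.succ = 0 := h (fun i => g i.succ) (by
    have := congrArg (span k {x}).mkQ hg
    simp only [map_add, map_smul, map_sum, map_zero, hw] at this
    rwa [(mkQ_apply _ x).trans ((Quotient.mk_eq_zero _).2 (mem_span_singleton_self x)), smul_zero,
      zero_add] at this)
  simp only [h1, zero_smul, Finset.sum_const_zero, add_zero, smul_eq_zero] at hg
  exact Fin.cases (hg.resolve_right hx) h1

theorem linearIndependent_mkQ_of_cons {V : Type*} [AddCommGroup V] [Module k V] {x : V}
    {m : ℕ} {v : Fin m → V} {w : Fin m → V ⧸ span k {x}}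
    (hw : ∀ i, (span k {x}).mkQ (v i) = w i) (h : LinearIndependent k (Matrix.vecCons x v)) :
    LinearIndependent k w := by
  rw [Fintype.linearIndependent_iff] at h ⊢
  intro g hg i
  have h1 : ∑ i, g i • v i ∈ span k {x} := by
    rw [← Quotient.mk_eq_zero, ← mkQ_apply, map_sum]
    simpa only [map_smul, hw] using hg
  obtain ⟨c, hc⟩ := mem_span_singleton.1 h1
  have := h (Fin.cons (-c) g) (by
    simp only [Fin.sum_univ_succ, Matrix.cons_val_zero, Matrix.cons_val_succ, Fin.cons_zero,
      Fin.cons_succ]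
    rw [← hc, neg_smul, neg_add_cancel]) i.succ
  simpa using this

/-- Left multiplication by `x`, acting on the quotient by the line through `x`. -/
def leftQuot {n : ℕ} {μ : AlgStr k n} (hμ : IsAlt μ) (x : Fin n → k) :
    ((Fin n → k) ⧸ span k {x}) →ₗ[k] (Fin n → k) ⧸ span k {x} :=
  (span k {x}).mapQ (span k {x}) (μ x) (by
    rw [span_le, Set.singleton_subset_iff, SetLike.mem_coe, mem_comap, hμ x]
    exact zero_mem _)

theorem leftQuot_mkQ {n : ℕ} {μ : AlgStr k n} (hμ : IsAlt μ) (x v : Fin n → k) :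
    leftQuot hμ x ((span k {x}).mkQ v) = (span k {x}).mkQ (μ x v) := rfl

theorem exists_functional_of_dependent {n : ℕ} {μ : AlgStr k n} (hμ : IsAlt μ)
    (h : ∀ x y, ¬LinearIndependent k ![x, y, μ x y]) :
    ∃ f : (Fin n → k) →ₗ[k] k, ∀ x y, μ x y = f x • y - f y • x := by
  have hex : ∀ x, x ≠ 0 → ∃ c : k, ∀ y, ∃ d : k, μ x y = c • y + d • x := by
    intro x hx
    obtain ⟨c, hc⟩ := LinearMap.exists_eq_smul_id_of_forall_notLinearIndependent
      (f := leftQuot hμ x) (fun v hv => by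
        obtain ⟨y, rfl⟩ := (span k {x}).mkQ_surjective v
        refine h x y (linearIndependent_cons_of_mkQ hx
      (fun i => by fin_cases i <;> rfl) hv))
    refine ⟨c, fun y => ?_⟩
    have h1 : μ x y - c • y ∈ span k {x} := by
      rw [← Quotient.mk_eq_zero, ← mkQ_apply, map_sub, ← leftQuot_mkQ hμ, hc, map_smul, sub_eq_zero]
      rfl
    obtain ⟨d, hd⟩ := mem_span_singleton.1 h1
    exact ⟨d, by rw [hd]; module⟩
  let e := Pi.basisFun k (Fin n)
  choose c hc using fun i => hex (e i) (e.ne_zero i)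
  refine ⟨e.constr k c, ?_⟩
  have hwedge : μ = wedgeStr (e.constr k c) LinearMap.id := by
    refine algStr_ext_basis e fun i j => ?_
    rw [wedgeStr_apply, LinearMap.id_apply, LinearMap.id_apply, e.constr_basis, e.constr_basis]
    rcases eq_or_ne i j with rfl | hij
    · rw [hμ, sub_self]
    · obtain ⟨d, hd⟩ := hc i (e j)
      obtain ⟨d', hd'⟩ := hc j (e i)
      have hneg := hμ.neg (e i) (e j)
      rw [hd, hd'] at hneg
      have hli : LinearIndependent k ![e i, e j] := by
        have := e.linearIndependent.comp ![i, j] (by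
          intro a b hab
          fin_cases a <;> fin_cases b <;> simp_all [hij.symm])
        convert this using 1
        ext a; fin_cases a <;> rfl
      rw [LinearIndependent.pair_iff] at hli
      have := (hli (c j + d) (d' + c i) (by rw [← sub_eq_zero] at hneg; rw [← hneg]; module)).1
      rw [hd, eq_neg_of_add_eq_zero_right this]; module
  intro x y
  conv_lhs => rw [hwedge]
  rfl

/-- The structures that turn out to be the representatives of level two. -/
def IsListed (n : ℕ) (χ : AlgStr k n) : Prop :=
  (∃ α β : k, (α, β) ≠ (0, 0) ∧ χ = T02str n α β) ∨ (n = 4 ∧ χ = T03str n) ∨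
    (5 ≤ n ∧ (χ = T022str n ∨ χ = etaStr n 2))

theorem exists_scalar_add_rank_one_leftQuot [IsAlgClosed k] {n : ℕ} (hn : 3 ≤ n)
    {μ : AlgStr k n} (hμ : IsAlt μ) {x : Fin n → k} (hx : x ≠ 0)
    (hL : ∀ χ, IsListed n χ → ¬degenerates μ χ) :
    ∃ (β : k) (w : (Fin n → k) ⧸ span k {x}), ∀ z, ∃ c : k,
      leftQuot hμ x z = β • z + c • w := by
  have hQ : Module.finrank k ((Fin n → k) ⧸ span k {x}) + 1 = n := by
    have := (span k {x}).finrank_quotient_add_finrank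
    rwa [finrank_span_singleton hx, Module.finrank_fin_fun] at this
  obtain h3 | h4 | h5 : n = 3 ∨ n = 4 ∨ 5 ≤ n := by omega
  · exact exists_scalar_add_rank_one_of_two (by omega) _
  · refine exists_scalar_add_rank_one_of_three (by omega) _ fun v hv => ?_
    obtain ⟨y, rfl⟩ := (span k {x}).mkQ_surjective v
    refine hL _ (Or.inr (Or.inl ⟨h4, rfl⟩)) (degenerates_T03str hμ (x := x) (v := y)
      (linearIndependent_cons_of_mkQ hx
      (fun i => by fin_cases i <;> rfl) hv))
  · refine exists_scalar_add_rank_one_of_four_le (by omega) _ fun u v huv => ?_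
    obtain ⟨u, rfl⟩ := (span k {x}).mkQ_surjective u
    obtain ⟨v, rfl⟩ := (span k {x}).mkQ_surjective v
    refine hL _ (Or.inr (Or.inr ⟨h5, Or.inl rfl⟩)) (degenerates_T022str hμ (x := x) (u := u)
      (v := v) (linearIndependent_cons_of_mkQ hx
      (fun i => by fin_cases i <;> rfl) huv))

theorem nilpotent_of_linearIndependent [IsAlgClosed k] {n : ℕ} {μ : AlgStr k n} (hμ : IsAlt μ)
    {x y : Fin n → k} (hxy : LinearIndependent k ![x, y, μ x y])
    (hL : ∀ χ, IsListed n χ → ¬degenerates μ χ) :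
    (∀ z, μ x (μ x z) ∈ span k {x}) ∧ ∀ u v, ¬LinearIndependent k ![x, μ x u, μ x v] := by
  have hn : 3 ≤ n := le_of_linearIndependent hxy
  have hx : x ≠ 0 := hxy.ne_zero 0
  obtain ⟨β, w₀, hw₀⟩ := exists_scalar_add_rank_one_leftQuot hn hμ hx hL
  set π := (span k {x}).mkQ with hπ
  set M := leftQuot hμ x with hM
  have hvw : LinearIndependent k ![π y, M (π y)] :=
    linearIndependent_mkQ_of_cons (fun i => by fin_cases i <;> rfl) hxy
  obtain ⟨c₀, hc₀⟩ := hw₀ (π y)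
  have hc₀0 : c₀ ≠ 0 := by
    rintro rfl
    rw [zero_smul, add_zero] at hc₀
    rw [LinearIndependent.pair_iff] at hvw
    have := (hvw β (-1) (by rw [hc₀]; module)).2
    simp at this
  set w := M (π y) - β • π y with hw
  have hyw : LinearIndependent k ![π y, w] := linearIndependent_apply_sub hvw β
  have hform : ∀ z, ∃ c : k, M z = β • z + c • w := fun z => by
    obtain ⟨c, hc⟩ := hw₀ z
    refine ⟨c * c₀⁻¹, ?_⟩
    rw [hc, hw, hc₀, add_sub_cancel_left, smul_smul, mul_assoc, inv_mul_cancel₀ hc₀0, mul_one]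
  obtain ⟨c, hc⟩ := hform w
  have hMy : M (π y) = β • π y + w := by rw [hw]; module
  have heig : M (w - c • π y) = β • (w - c • π y) := by
    rw [map_sub, map_smul, hc, hMy]; module
  by_cases hαβ : (β + c, β) = ((0 : k), (0 : k))
  · rw [Prod.mk.injEq] at hαβ
    obtain ⟨h1, rfl⟩ := hαβ
    rw [zero_add] at h1
    subst h1
    rw [zero_smul, add_zero] at hc
    refine ⟨fun z => ?_, fun u v huv => ?_⟩
    · rw [← Quotient.mk_eq_zero, ← mkQ_apply, ← hπ, hπ, ← leftQuot_mkQ hμ, ← leftQuot_mkQ hμ]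
      obtain ⟨d, hd⟩ := hform (π z)
      rw [← hπ, ← hM, hd, zero_smul, zero_add, map_smul, hc, smul_zero]
    · have h2 : LinearIndependent k ![M (π u), M (π v)] :=
    linearIndependent_mkQ_of_cons (fun i => by fin_cases i <;> rfl) huv
      obtain ⟨d, hd⟩ := hform (π u)
      obtain ⟨d', hd'⟩ := hform (π v)
      rw [hd, hd'] at h2
      simp only [zero_smul, zero_add] at h2
      have h3 := LinearIndependent.pair_iff.1 h2 d' (-d) (by module)
      have h4 := h2.ne_zero 1
      rw [h3.1] at hd'
      exact h4 (by simp [h3.1])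
  · exfalso
    obtain ⟨e, he⟩ := (span k {x}).mkQ_surjective (w - c • π y)
    rw [← hπ] at he
    have hye : LinearIndependent k ![x, y, e] := by
      refine linearIndependent_cons_of_mkQ hx (w := ![π y, π e])
        (fun i => by fin_cases i <;> rfl) ?_
      have : LinearIndependent k ![π y, w - c • π y] := by
        rw [LinearIndependent.pair_iff] at hyw ⊢
        intro a b hab
        obtain ⟨h1, h2⟩ := hyw (a - b * c) b (by rw [← hab]; module)
        subst h2
        simpa using h1
      rwa [← he] at this
    let E : Submodule k (Fin n → k) := LinearMap.ker ((M - β • LinearMap.id).comp π)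
    have hE : ∀ z, z ∈ E ↔ M (π z) = β • π z := fun z => by
      simp [E, sub_eq_zero]
    have htop : span k (Set.range ![x, y, e]) ⊔ E = ⊤ := by
      refine eq_top_iff.2 fun z _ => ?_
      obtain ⟨d, hd⟩ := hform (π z)
      have : z = d • y + (z - d • y) := by module
      rw [this]
      refine Submodule.add_mem_sup (smul_mem _ _ (subset_span ⟨1, rfl⟩)) ((hE _).2 ?_)
      rw [map_sub, map_sub, map_smul, map_smul, hd, hMy]; module
    obtain ⟨b, hb, hbE⟩ := exists_basis_extend _ hye E htop
    have b0 : b ⟨0, by omega⟩ = x := by rw [hb _ (by norm_num)]; rfl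
    have b1 : b ⟨1, by omega⟩ = y := by rw [hb _ (by norm_num)]; rfl
    have b2 : b ⟨2, by omega⟩ = e := by rw [hb _ (by norm_num)]; rfl
    have hmod : ∀ {p q : Fin n → k}, π p = π q → ∃ a : k, p = a • x + q := by
      intro p q hpq
      have h1 : p - q ∈ span k {x} := by
        rw [← Quotient.mk_eq_zero, ← mkQ_apply, map_sub, sub_eq_zero]
        exact hpq
      obtain ⟨a, ha⟩ := mem_span_singleton.1 h1
      exact ⟨a, by rw [ha]; module⟩
    refine hL _ (Or.inl ⟨β + c, β, hαβ, rfl⟩) (degenerates_T02str hn hμ b ?_ ?_)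
    · rw [b0, b1, b2]
      obtain ⟨a, ha⟩ := hmod (p := μ x y) (q := (β + c) • y + e) (by
        rw [map_add, map_smul, he]
        calc π (μ x y) = M (π y) := rfl
          _ = _ := by rw [hMy]; module)
      exact ⟨a, by rw [ha]; module⟩
    · intro j hj
      rw [b0]
      refine hmod ?_
      rw [map_smul]
      calc π (μ x (b j)) = M (π (b j)) := rfl
        _ = β • π (b j) := by
          rcases eq_or_lt_of_le hj with h2 | h2
          · have : j = ⟨2, by omega⟩ := Fin.ext h2.symm
            rw [this, b2, he, heig]
          · exact (hE _).1 (hbE j h2)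

end LeftMultiplication

/-! ### Generic linear independence along a line -/

section Generic

theorem exists_det_functional_ne_zero {n m : ℕ} {v : Fin m → Fin n → k}
    (hv : LinearIndependent k v) : ∃ φ : Fin m → (Fin n → k) →ₗ[k] k,
      (Matrix.of fun i j => φ i (v j)).det ≠ 0 := by
  obtain ⟨b, hb⟩ := exists_basis_extend_top _ hv
  have hm := le_of_linearIndependent hv
  refine ⟨fun i => b.coord (Fin.castLE hm i), ?_⟩
  have : (Matrix.of fun i j : Fin m => b.coord (Fin.castLE hm i) (v j)) = 1 := by
    ext i j
    have hj : v j = b (Fin.castLE hm j) := (hb (Fin.castLE hm j) j.2).symm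
    rw [Matrix.of_apply, hj, Module.Basis.coord_apply, b.repr_self, Finsupp.single_apply,
      Matrix.one_apply]
    simp [Fin.ext_iff, eq_comm]
  rw [this, Matrix.det_one]
  exact one_ne_zero

theorem linearIndependent_of_det_functional_ne_zero {n m : ℕ} {v : Fin m → Fin n → k}
    (φ : Fin m → (Fin n → k) →ₗ[k] k) (h : (Matrix.of fun i j => φ i (v j)).det ≠ 0) :
    LinearIndependent k v := by
  rw [Fintype.linearIndependent_iff]
  intro g hg
  refine fun i => congrFun (Matrix.eq_zero_of_mulVec_eq_zero h (v := g) (funext fun i => ?_)) i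
  have := congrArg (φ i) hg
  simpa [Matrix.mulVec, dotProduct, mul_comm] using this

theorem det_functional_mem {X : Type*} (S : Subalgebra k (X → k)) {n m : ℕ}
    {F : X → Fin m → Fin n → k} (hF : ∀ j, VecReg S fun t => F t j)
    (φ : Fin m → (Fin n → k) →ₗ[k] k) :
    (fun t => (Matrix.of fun i j => φ i (F t j)).det) ∈ S := by
  have : (fun t => (Matrix.of fun i j => φ i (F t j)).det) =
      ∑ σ : Equiv.Perm (Fin m), algebraMap k (X → k) ((Equiv.Perm.sign σ : ℤ) : k) *
        ∏ i, fun t => φ (σ i) (F t i) := by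
    funext t
    simp [Matrix.det_apply', Finset.sum_apply, Finset.prod_apply]
  rw [this]
  exact S.sum_mem fun σ _ => S.mul_mem (S.algebraMap_mem _)
    (S.prod_mem fun i _ => (hF i).functional _)

theorem not_linearIndependent_of_generic [Infinite k] {n p q : ℕ} {F : k → Fin p → Fin n → k}
    {G : k → Fin q → Fin n → k}
    (hF : ∀ j, VecReg (Polynomial.aeval (R := k) (id : k → k)).range fun t => F t j)
    (hG : ∀ j, VecReg (Polynomial.aeval (R := k) (id : k → k)).range fun t => G t j)
    {t₀ : k} (h₀ : LinearIndependent k (F t₀))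
    (h : ∀ t, LinearIndependent k (F t) → ¬LinearIndependent k (G t)) (t : k) :
    ¬LinearIndependent k (G t) := by
  intro ht
  obtain ⟨φ, hφ⟩ := exists_det_functional_ne_zero h₀
  obtain ⟨ψ, hψ⟩ := exists_det_functional_ne_zero ht
  obtain ⟨P, hP⟩ := det_functional_mem _ hF φ
  obtain ⟨R, hR⟩ := det_functional_mem _ hG ψ
  have hP' : ∀ s, P.eval s = (Matrix.of fun i j => φ i (F s j)).det := fun s => by
    rw [← aeval_id_fun_apply]; exact congrFun hP s
  have hR' : ∀ s, R.eval s = (Matrix.of fun i j => ψ i (G s j)).det := fun s => by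
    rw [← aeval_id_fun_apply]; exact congrFun hR s
  have hmul : P * R = 0 := Polynomial.funext fun s => by
    rw [Polynomial.eval_mul, Polynomial.eval_zero, mul_eq_zero, hP', hR']
    by_contra! hne
    exact h s (linearIndependent_of_det_functional_ne_zero φ hne.1)
      (linearIndependent_of_det_functional_ne_zero ψ hne.2)
  rcases mul_eq_zero.1 hmul with h0 | h0
  · exact hφ (by rw [← hP', h0, Polynomial.eval_zero])
  · exact hψ (by rw [← hR', h0, Polynomial.eval_zero])

theorem vecReg_line {n : ℕ} (x y : Fin n → k) :
    VecReg (Polynomial.aeval (R := k) (id : k → k)).range fun t : k => x + t • y := fun i =>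
  ⟨Polynomial.C (x i) + Polynomial.X * Polynomial.C (y i), funext fun t => by
    change Polynomial.aeval (R := k) (id : k → k) _ t = _
    rw [aeval_id_fun_apply]
    simp
    exact mul_comm _ _⟩

theorem VecReg.map_line {n : ℕ} (μ : AlgStr k n) {F G : k → Fin n → k}
    (hF : VecReg (Polynomial.aeval (R := k) (id : k → k)).range F)
    (hG : VecReg (Polynomial.aeval (R := k) (id : k → k)).range G) :
    VecReg (Polynomial.aeval (R := k) (id : k → k)).range fun t => μ (F t) (G t) :=
  VecReg.algStr_apply (M := fun _ => μ) (fun t => Subalgebra.algebraMap_mem _ (structConst μ t))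
    hF hG

theorem nilpotent_of_not_listed [IsAlgClosed k] {n : ℕ} {μ : AlgStr k n} (hμ : IsAlt μ)
    {x₀ y₀ : Fin n → k} (hxy : LinearIndependent k ![x₀, y₀, μ x₀ y₀])
    (hL : ∀ χ, IsListed n χ → ¬degenerates μ χ) (x : Fin n → k) :
    (∀ z, ¬LinearIndependent k ![x, μ x (μ x z)]) ∧
      ∀ u v, ¬LinearIndependent k ![x, μ x u, μ x v] := by
  have : Infinite k := IsAlgClosed.instInfinite
  have hx := vecReg_line x₀ (x - x₀)
  have hc : ∀ z : Fin n → k,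
      VecReg (Polynomial.aeval (R := k) (id : k → k)).range fun _ : k => z :=
    fun z => VecReg.const z
  have hF : ∀ j, VecReg (Polynomial.aeval (R := k) (id : k → k)).range fun t =>
      (![x₀ + t • (x - x₀), y₀, μ (x₀ + t • (x - x₀)) y₀] : Fin 3 → Fin n → k) j := by
    intro j
    fin_cases j
    · exact hx
    · exact hc y₀
    · exact VecReg.map_line μ hx (hc y₀)
  have h₀ : LinearIndependent k
      ![x₀ + (0 : k) • (x - x₀), y₀, μ (x₀ + (0 : k) • (x - x₀)) y₀] := by
    simpa using hxy
  have h1 : x₀ + (1 : k) • (x - x₀) = x := by module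
  constructor
  · intro z
    have := not_linearIndependent_of_generic hF (G := fun t =>
      ![x₀ + t • (x - x₀), μ (x₀ + t • (x - x₀)) (μ (x₀ + t • (x - x₀)) z)]) (fun j => by
        fin_cases j
        · exact hx
        · exact VecReg.map_line μ hx (VecReg.map_line μ hx (hc z))) h₀ (fun t ht hli => by
        obtain ⟨c, hcz⟩ := Submodule.mem_span_singleton.1
          ((nilpotent_of_linearIndependent hμ ht hL).1 z)
        rw [← hcz] at hli
        have := (LinearIndependent.pair_iff.1 hli c (-1) (by module)).2
        simp at this) 1
    rwa [h1] at this
  · intro u v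
    have := not_linearIndependent_of_generic hF (G := fun t =>
      ![x₀ + t • (x - x₀), μ (x₀ + t • (x - x₀)) u, μ (x₀ + t • (x - x₀)) v]) (fun j => by
        fin_cases j
        · exact hx
        · exact VecReg.map_line μ hx (hc u)
        · exact VecReg.map_line μ hx (hc v)) h₀
      (fun t ht => (nilpotent_of_linearIndependent hμ ht hL).2 u v) 1
    rwa [h1] at this

/-- Rank-two alternating algebras with central square. -/
theorem exists_form_of_not_listed [IsAlgClosed k] {n : ℕ} {μ : AlgStr k n} (hμ : IsAlt μ)
    {x₀ y₀ : Fin n → k} (hxy : LinearIndependent k ![x₀, y₀, μ x₀ y₀])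
    (hL : ∀ χ, IsListed n χ → ¬degenerates μ χ) :
    (∀ x y, ∃ c : k, μ x y = c • μ x₀ y₀) ∧ ∀ x, μ x (μ x₀ y₀) = 0 := by
  have hnil := nilpotent_of_not_listed hμ hxy hL
  have hA : ∀ x y : Fin n → k, ∀ c : k, x ≠ 0 → μ y x = c • x → c = 0 := by
    intro x y c hx hyx
    by_contra hc
    have hy : y ≠ 0 := by
      rintro rfl
      rw [map_zero, LinearMap.zero_apply] at hyx
      exact (smul_ne_zero hc hx) hyx.symm
    have := (hnil y).1 x
    rw [hyx, map_smul, hyx, smul_smul, LinearIndependent.pair_iff' hy] at this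
    push Not at this
    obtain ⟨s, hs⟩ := this
    have h0 : μ y ((c * c) • x) = 0 := by rw [← hs, map_smul, hμ, smul_zero]
    rw [map_smul, hyx, smul_smul] at h0
    exact (smul_ne_zero (mul_ne_zero (mul_ne_zero hc hc) hc) hx) h0
  have hC : ∀ x v : Fin n → k, ∀ c : k, x ≠ 0 → μ x v = c • x → c = 0 := by
    intro x v c hx hxv
    have := hA x v (-c) hx (by rw [hμ.neg, hxv, neg_smul])
    simpa using this
  have hD : ∀ x u v : Fin n → k, μ x u ≠ 0 → ∃ c : k, μ x v = c • μ x u := by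
    intro x u v hxu
    have hx : x ≠ 0 := by
      rintro rfl
      exact hxu (by rw [map_zero, LinearMap.zero_apply])
    have := (hnil x).2 u v
    rw [Fintype.linearIndependent_iff] at this
    push Not at this
    obtain ⟨g, hg, i, hi⟩ := this
    simp only [Fin.sum_univ_three, Matrix.cons_val] at hg
    have h0 : g 0 = 0 := by
      have := hC x (g 1 • u + g 2 • v) (-g 0) hx (by
        rw [map_add, map_smul, map_smul, neg_smul, eq_neg_iff_add_eq_zero, ← hg]
        abel)
      simpa using this
    rw [h0, zero_smul, zero_add] at hg
    have h2 : g 2 ≠ 0 := by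
      intro h2
      rw [h2, zero_smul, add_zero, smul_eq_zero, or_iff_left hxu] at hg
      fin_cases i
      · exact hi h0
      · exact hi hg
      · exact hi h2
    refine ⟨-((g 2)⁻¹ * g 1), ?_⟩
    rw [neg_smul, mul_smul, eq_neg_of_add_eq_zero_left hg, smul_neg, neg_neg, smul_smul,
      inv_mul_cancel₀ h2, one_smul]
  have hw : μ x₀ y₀ ≠ 0 := hxy.ne_zero 2
  have hD' : ∀ x y : Fin n → k, μ x y₀ ≠ 0 → ∃ c : k, μ x y = c • μ x₀ y₀ := by
    intro x y hx
    obtain ⟨c, hc⟩ := hD y₀ x₀ x (by rw [hμ.neg]; exact neg_ne_zero.2 hw)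
    obtain ⟨d, hd⟩ := hD x y₀ y hx
    rw [hμ.neg x y₀, hμ.neg x₀ y₀, smul_neg, neg_inj] at hc
    exact ⟨d * c, by rw [hd, hc, smul_smul]⟩
  have hE : ∀ x y, ∃ c : k, μ x y = c • μ x₀ y₀ := by
    intro x y
    by_cases hx : μ x y₀ = 0
    · obtain ⟨c, hc⟩ := hD' (x + x₀) y (by rwa [map_add, LinearMap.add_apply, hx, zero_add])
      obtain ⟨d, hd⟩ := hD' x₀ y hw
      refine ⟨c - d, ?_⟩
      rw [map_add, LinearMap.add_apply] at hc
      rw [sub_smul, ← hc, ← hd, add_sub_cancel_right]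
    · exact hD' x y hx
  refine ⟨hE, fun x => ?_⟩
  obtain ⟨c, hc⟩ := hE x (μ x₀ y₀)
  rw [hc, hA _ x c hw hc, zero_smul]

theorem n3str_mem_orbit_of_not_listed [IsAlgClosed k] {n : ℕ} {μ : AlgStr k n} (hμ : IsAlt μ)
    {x y : Fin n → k} (hxy : LinearIndependent k ![x, y, μ x y])
    (hL : ∀ χ, IsListed n χ → ¬degenerates μ χ) : n3str n ∈ orbit μ := by
  have hn : 3 ≤ n := le_of_linearIndependent hxy
  obtain ⟨hE, hcen⟩ := exists_form_of_not_listed hμ hxy hL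
  set w := μ x y with hw
  have hw0 : w ≠ 0 := hxy.ne_zero 2
  let U : Submodule k (Fin n → k) := LinearMap.ker (μ x) ⊓ LinearMap.ker (μ y)
  have hU : ∀ z, z ∈ U ↔ μ x z = 0 ∧ μ y z = 0 := fun z => by simp [U]
  have hyx : μ y x = -w := hμ.neg x y
  by_cases hzero : ∀ u ∈ U, ∀ v ∈ U, μ u v = 0
  · have htop : Submodule.span k (Set.range ![x, y, w]) ⊔ U = ⊤ := by
      refine eq_top_iff.2 fun z _ => ?_
      obtain ⟨c, hc⟩ := hE x z
      obtain ⟨d, hd⟩ := hE y z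
      have : z = (c • y - d • x) + (z - c • y + d • x) := by module
      rw [this]
      refine Submodule.add_mem_sup (Submodule.sub_mem _
        (Submodule.smul_mem _ _ (Submodule.subset_span ⟨1, rfl⟩))
        (Submodule.smul_mem _ _ (Submodule.subset_span ⟨0, rfl⟩))) ((hU _).2 ⟨?_, ?_⟩)
      · rw [map_add, map_sub, map_smul, map_smul, hμ, ← hw, hc]; module
      · rw [map_add, map_sub, map_smul, map_smul, hμ, hyx, hd]; module
    obtain ⟨b, hb, hbU⟩ := exists_basis_extend _ hxy U htop
    have b0 : b ⟨0, by omega⟩ = x := by rw [hb _ (by norm_num)]; rfl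
    have b1 : b ⟨1, by omega⟩ = y := by rw [hb _ (by norm_num)]; rfl
    have b2 : b ⟨2, by omega⟩ = w := by rw [hb _ (by norm_num)]; rfl
    have hb' : ∀ j : Fin n, 2 ≤ (j : ℕ) → b j ∈ U := by
      intro j hj
      rcases eq_or_lt_of_le hj with h2 | h2
      · have : j = ⟨2, by omega⟩ := Fin.ext h2.symm
        rw [this, b2]
        exact (hU _).2 ⟨hcen x, hcen y⟩
      · exact hbU j h2
    refine n3str_mem_orbit hn hμ b (by rw [b0, b1, b2]) fun i j hij hj => ?_
    by_cases hi : 2 ≤ (i : ℕ)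
    · exact hzero _ (hb' i hi) _ (hb' j hj)
    · obtain h0 | h0 : (i : ℕ) = 0 ∨ (i : ℕ) = 1 := by omega
      · have : i = ⟨0, by omega⟩ := Fin.ext h0
        rw [this, b0]
        exact ((hU _).1 (hb' j hj)).1
      · have : i = ⟨1, by omega⟩ := Fin.ext h0
        rw [this, b1]
        exact ((hU _).1 (hb' j hj)).2
  · exfalso
    push Not at hzero
    obtain ⟨u, hu, v, hv, huv⟩ := hzero
    obtain ⟨c, hc⟩ := hE u v
    have hc0 : c ≠ 0 := by
      rintro rfl
      exact huv (by rw [hc, zero_smul])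
    have huv' : μ (c⁻¹ • u) v = w := by
      rw [map_smul, LinearMap.smul_apply, hc, smul_smul, inv_mul_cancel₀ hc0, one_smul]
    obtain ⟨hxu, hyu⟩ := (hU _).1 (U.smul_mem c⁻¹ hu)
    obtain ⟨hxv, hyv⟩ := (hU _).1 hv
    set t := c⁻¹ • u with ht
    have hli : LinearIndependent k ![x, y, t, v, w] := by
      rw [Fintype.linearIndependent_iff]
      intro g hg
      simp only [Fin.sum_univ_five, Matrix.cons_val] at hg
      have hcoef : ∀ s : Fin n → k, ∀ a : k, μ s (g 0 • x + g 1 • y + g 2 • t + g 3 • v + g 4 • w) =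
          a • w → a = 0 := fun s a h => by
        rw [hg, map_zero] at h
        exact (smul_eq_zero.1 h.symm).resolve_right hw0
      have g1 : g 1 = 0 := hcoef x _ (by
        simp only [map_add, map_smul, hμ x, ← hw, hxu, hxv, hcen]; module)
      have g0 : g 0 = 0 := neg_eq_zero.1 (hcoef y _ (by
        simp only [map_add, map_smul, hμ y, hyx, hyu, hyv, hcen]; module))
      have g3 : g 3 = 0 := hcoef t _ (by
        simp only [map_add, map_smul, hμ t, huv', hμ.neg x t, hμ.neg y t, hxu, hyu, hcen]; module)
      have g2 : g 2 = 0 := neg_eq_zero.1 (hcoef v _ (by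
        simp only [map_add, map_smul, hμ v, hμ.neg t v, huv', hμ.neg x v, hμ.neg y v, hxv, hyv,
          hcen]; module))
      have g4 : g 4 = 0 := by
        rw [g0, g1, g2, g3] at hg
        simp only [zero_smul, zero_add] at hg
        exact (smul_eq_zero.1 hg).resolve_right hw0
      intro i
      fin_cases i <;> assumption
    have : Infinite k := IsAlgClosed.instInfinite
    exact hL _ (Or.inr (Or.inr ⟨le_of_linearIndependent hli, Or.inr rfl⟩))
      (degenerates_etaStr hμ hli hw.symm huv' hxu hxv hyu hyv)

theorem eq_zero_or_pminusStr_mem_orbit {n : ℕ} {μ : AlgStr k n} (hμ : IsAlt μ)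
    (h : ∀ x y, ¬LinearIndependent k ![x, y, μ x y]) : μ = 0 ∨ pminusStr n ∈ orbit μ := by
  obtain ⟨f, hf⟩ := exists_functional_of_dependent hμ h
  by_cases hf0 : f = 0
  · left
    refine LinearMap.ext fun x => LinearMap.ext fun y => ?_
    rw [hf, hf0]; simp
  · exact Or.inr (pminusStr_mem_orbit f hf0 hf)

/-- Every alternating structure is trivial, of level one, or degenerates to a listed structure. -/
theorem classification [IsAlgClosed k] {n : ℕ} {μ : AlgStr k n} (hμ : IsAlt μ) :
    μ = 0 ∨ pminusStr n ∈ orbit μ ∨ (3 ≤ n ∧ n3str n ∈ orbit μ) ∨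
      ∃ χ, IsListed n χ ∧ degenerates μ χ := by
  by_cases h : ∀ x y, ¬LinearIndependent k ![x, y, μ x y]
  · exact (eq_zero_or_pminusStr_mem_orbit hμ h).imp_right Or.inl
  · push Not at h
    obtain ⟨x, y, hxy⟩ := h
    by_cases hL : ∃ χ, IsListed n χ ∧ degenerates μ χ
    · exact Or.inr (Or.inr (Or.inr hL))
    · push Not at hL
      exact Or.inr (Or.inr (Or.inl ⟨le_of_linearIndependent hxy,
        n3str_mem_orbit_of_not_listed hμ hxy hL⟩))

end Generic

theorem linearIndependent_unitVec_of_coord {n c : ℕ} (h2 : 2 ≤ c) (hc : c < n) {v : Fin n → k}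
    (hv : coord k n c v ≠ 0) : LinearIndependent k ![unitVec n 0, unitVec n 1, v] := by
  refine linearIndependent_of_det_functional_ne_zero
    ![coord k n 0, coord k n 1, coord k n c] ?_
  simp [Matrix.det_fin_three, coord_unitVec_self (show 0 < n by omega),
    coord_unitVec_self (show 1 < n by omega), coord_unitVec_of_ne,
    coord_unitVec_of_ne (show c ≠ 0 by omega), coord_unitVec_of_ne (show c ≠ 1 by omega), hv]

theorem n3str_linearIndependent {n : ℕ} (hn : 3 ≤ n) : LinearIndependent k
    ![unitVec n 0, unitVec n 1, (n3str n : AlgStr k n) (unitVec n 0) (unitVec n 1)] := by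
  refine linearIndependent_unitVec_of_coord le_rfl (show 2 < n by omega) ?_
  simp [n3str_eq, wedgeStr_apply, coord_unitVec_of_ne, coord_unitVec_self (show 0 < n by omega),
    coord_unitVec_self (show 1 < n by omega), coord_unitVec_self (show 2 < n by omega)]

theorem IsListed.linearIndependent {n : ℕ} (hn : 3 ≤ n) {χ : AlgStr k n} (h : IsListed n χ) :
    LinearIndependent k ![unitVec n 0, unitVec n 1, χ (unitVec n 0) (unitVec n 1)] := by
  rcases h with ⟨α, β, -, rfl⟩ | ⟨-, rfl⟩ | ⟨h5, rfl | rfl⟩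
  · refine linearIndependent_unitVec_of_coord le_rfl (show 2 < n by omega) ?_
    simp [T02str_eq, wedgeStr_apply, coord_unitVec_of_ne, coord_unitVec_self (show 0 < n by omega),
      coord_unitVec_self (show 1 < n by omega), coord_unitVec_self (show 2 < n by omega)]
  · refine linearIndependent_unitVec_of_coord le_rfl (show 2 < n by omega) ?_
    simp [T03str_eq, wedgeStr_apply, coord_unitVec_of_ne, coord_unitVec_self (show 0 < n by omega),
      coord_unitVec_self (show 1 < n by omega), coord_unitVec_self (show 2 < n by omega)]
  · refine linearIndependent_unitVec_of_coord le_rfl (show 2 < n by omega) ?_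
    simp [T022str_eq, wedgeStr_apply, coord_unitVec_of_ne,
      coord_unitVec_self (show 0 < n by omega),
      coord_unitVec_self (show 1 < n by omega), coord_unitVec_self (show 2 < n by omega)]
  · refine linearIndependent_unitVec_of_coord (show 2 ≤ 4 by omega) (show 4 < n by omega) ?_
    simp [etaStr_two_eq, wedgeStr_apply, coord_unitVec_of_ne,
      coord_unitVec_self (show 0 < n by omega),
      coord_unitVec_self (show 1 < n by omega), coord_unitVec_self (show 4 < n by omega)]

theorem IsListed.isAlt {n : ℕ} {χ : AlgStr k n} (h : IsListed n χ) : IsAlt χ := by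
  rcases h with ⟨α, β, -, rfl⟩ | ⟨-, rfl⟩ | ⟨h5, rfl | rfl⟩
  exacts [isAlt_T02str n α β, isAlt_T03str n, isAlt_T022str n, isAlt_etaStr n 2]

theorem degenerates.eq_zero_of_zero {n : ℕ} {χ : AlgStr k n} (h : degenerates 0 χ) : χ = 0 := by
  refine LinearMap.ext fun x => LinearMap.ext fun y => eq_zero_of_functional fun φ => ?_
  refine h.eq_zero (r := fun ν => φ (ν x y)) (regFun_mul_const φ x y) ?_
  rintro ν ⟨g, rfl⟩
  simp [transport]

theorem hasChain_zero {n : ℕ} (μ : AlgStr k n) : hasChain μ 0 :=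
  ⟨fun _ => μ, rfl, fun i hi => absurd hi (Nat.not_lt_zero i)⟩

theorem hasChain_succ {n : ℕ} {μ : AlgStr k n} {m : ℕ} :
    hasChain μ (m + 1) ↔ ∃ χ, properlyDegenerates μ χ ∧ hasChain χ m := by
  constructor
  · rintro ⟨c, rfl, hc⟩
    exact ⟨c m, hc m m.lt_succ_self, c, rfl, fun i hi => hc i (hi.trans m.lt_succ_self)⟩
  · rintro ⟨χ, hχ, c, rfl, hc⟩
    refine ⟨fun i => if i ≤ m then c i else μ, by simp, fun i hi => ?_⟩
    rcases (Nat.lt_succ_iff.1 hi).lt_or_eq with h | rfl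
    · have h1 : i + 1 ≤ m := h
      simpa [h1, h.le] using hc i h
    · simpa using hχ

theorem properlyDegenerates.of_mem_orbit {n : ℕ} {μ ν χ : AlgStr k n}
    (h : properlyDegenerates μ χ) (hν : ν ∈ orbit μ) : properlyDegenerates ν χ :=
  ⟨(degenerates_of_mem_orbit (mem_orbit_symm hν)).trans h.1,
    fun h' => h.2 (mem_orbit_trans hν h')⟩

theorem hasChain.of_mem_orbit {n : ℕ} {μ ν : AlgStr k n} {m : ℕ} (h : hasChain μ m)
    (hν : ν ∈ orbit μ) : hasChain ν m := by
  cases m with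
  | zero => exact hasChain_zero ν
  | succ m =>
    obtain ⟨χ, hχ, hm⟩ := hasChain_succ.1 h
    exact hasChain_succ.2 ⟨χ, hχ.of_mem_orbit hν, hm⟩

theorem levelIs.of_mem_orbit {n : ℕ} {μ ν : AlgStr k n} {m : ℕ} (h : levelIs μ m)
    (hν : ν ∈ orbit μ) : levelIs ν m :=
  ⟨h.1.of_mem_orbit hν, fun h' => h.2 (h'.of_mem_orbit (mem_orbit_symm hν))⟩

theorem not_hasChain_one_zero {n : ℕ} : ¬ hasChain (0 : AlgStr k n) 1 := fun h => by
  obtain ⟨χ, hχ, -⟩ := hasChain_succ.1 h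
  exact hχ.2 (hχ.1.eq_zero_of_zero ▸ mem_orbit_self _)

theorem not_hasChain_two_of_zero_or_pminus {n : ℕ} {μ : AlgStr k n}
    (h : μ = 0 ∨ pminusStr n ∈ orbit μ) : ¬ hasChain μ 2 := fun hc => by
  obtain ⟨χ, hχ, hc1⟩ := hasChain_succ.1 hc
  rcases h with rfl | h
  · exact not_hasChain_one_zero (hasChain_succ.2 ⟨χ, hχ, hasChain_zero χ⟩)
  · have hχ' := hχ.of_mem_orbit h
    rcases eq_zero_or_pminusStr_mem_orbit (hχ'.1.isAlt (isAlt_pminusStr n))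
      (degenerates_pminus_dependent hχ'.1) with rfl | h1
    · exact not_hasChain_one_zero hc1
    · exact hχ'.2 (mem_orbit_symm h1)

theorem not_hasChain_two_of_le_two {n : ℕ} (hn : n ≤ 2) {μ : AlgStr k n} (hμ : IsAlt μ) :
    ¬ hasChain μ 2 :=
  not_hasChain_two_of_zero_or_pminus <| eq_zero_or_pminusStr_mem_orbit hμ fun _ _ h => by
    have := le_of_linearIndependent h
    omega

theorem n3_not_degenerates_listed {n : ℕ} (hn : 3 ≤ n) {χ : AlgStr k n} (h : IsListed n χ) :
    ¬ degenerates (n3str n) χ := by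
  rcases h with ⟨α, β, hαβ, rfl⟩ | ⟨h4, rfl⟩ | ⟨h5, rfl | rfl⟩
  exacts [not_degenerates_T02_of_nilpotent hn hαβ n3_nilpotent,
    not_degenerates_T03_of_nilpotent h4.ge n3_nilpotent, n3_not_degenerates_T022 h5,
    n3_not_degenerates_eta h5]

theorem not_hasChain_two_of_n3str_mem_orbit [IsAlgClosed k] {n : ℕ} (hn : 3 ≤ n)
    {μ : AlgStr k n} (h : n3str n ∈ orbit μ) : ¬ hasChain μ 2 := fun hc => by
  obtain ⟨χ, hχ, hc1⟩ := hasChain_succ.1 (hc.of_mem_orbit h)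
  rcases classification (hχ.1.isAlt (isAlt_n3str n)) with rfl | h1 | ⟨-, h1⟩ | ⟨ψ, hψ, h1⟩
  · exact not_hasChain_one_zero hc1
  · exact n3_not_degenerates_pminus (by omega) (hχ.1.trans (degenerates_of_mem_orbit h1))
  · exact hχ.2 (mem_orbit_symm h1)
  · exact n3_not_degenerates_listed hn hψ (hχ.1.trans h1)

theorem hasChain_two_of_listed [IsAlgClosed k] {n : ℕ} (hn : 3 ≤ n) {χ : AlgStr k n}
    (h : IsListed n χ) : hasChain χ 2 := by
  have := IsAlgClosed.instInfinite (K := k)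
  refine hasChain_succ.2 ⟨n3str n, ⟨degenerates_n3str h.isAlt (h.linearIndependent hn),
    fun h1 => n3_not_degenerates_listed hn h (degenerates_of_mem_orbit (mem_orbit_symm h1))⟩,
    hasChain_succ.2 ⟨0, ⟨degenerates_zero (isAlt_n3str n), fun h1 => ?_⟩, hasChain_zero 0⟩⟩
  have h0 := (degenerates_of_mem_orbit (mem_orbit_symm h1)).eq_zero_of_zero
  refine (n3str_linearIndependent (k := k) hn).ne_zero 2 ?_
  rw [h0]; rfl

theorem IsListed.mem_orbit_of_degenerates {n : ℕ} (hn : 3 ≤ n) {χ ψ : AlgStr k n}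
    (h : IsListed n χ) (h' : IsListed n ψ) (hd : degenerates χ ψ) : ψ ∈ orbit χ := by
  rcases h with ⟨α, β, hαβ, rfl⟩ | ⟨h4, rfl⟩ | ⟨h5, rfl | rfl⟩ <;>
    rcases h' with ⟨α', β', hαβ', rfl⟩ | ⟨h4', rfl⟩ | ⟨h5', rfl | rfl⟩
  · exact T02_mem_orbit_of_degenerates hn hαβ hαβ' hd
  · exact absurd hd (T02_not_degenerates_T03 h4'.ge α β)
  · exact absurd hd (T02_not_degenerates_T022 h5' α β)
  · exact absurd hd (T02_not_degenerates_eta h5' α β)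
  · exact absurd hd (T03_not_degenerates_T02 hn hαβ')
  · exact mem_orbit_self _
  · omega
  · omega
  · exact absurd hd (not_degenerates_T02_of_nilpotent hn hαβ' T022_nilpotent)
  · omega
  · exact mem_orbit_self _
  · exact absurd hd (T022_not_degenerates_eta h5)
  · exact absurd hd (not_degenerates_T02_of_nilpotent hn hαβ' eta_nilpotent)
  · omega
  · exact absurd hd (eta_not_degenerates_T022 h5)
  · exact mem_orbit_self _

theorem not_hasChain_two_or_listed [IsAlgClosed k] {n : ℕ} {μ : AlgStr k n}
    (hμ : IsAlt μ) : ¬ hasChain μ 2 ∨ ∃ χ, IsListed n χ ∧ degenerates μ χ := by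
  rcases classification hμ with h | h | ⟨hn, h⟩ | h
  · exact Or.inl (not_hasChain_two_of_zero_or_pminus (Or.inl h))
  · exact Or.inl (not_hasChain_two_of_zero_or_pminus (Or.inr h))
  · exact Or.inl (not_hasChain_two_of_n3str_mem_orbit hn h)
  · exact Or.inr h

theorem levelIs_two_iff [IsAlgClosed k] {n : ℕ} (hn : 3 ≤ n) {μ : AlgStr k n} (hμ : IsAlt μ) :
    levelIs μ 2 ↔ ∃ χ, IsListed n χ ∧ μ ∈ orbit χ := by
  constructor
  · rintro ⟨h2, h3⟩
    obtain ⟨χ, hχ, hd⟩ := (not_hasChain_two_or_listed hμ).resolve_left (not_not.2 h2)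
    refine ⟨χ, hχ, mem_orbit_symm ?_⟩
    by_contra h
    exact h3 (hasChain_succ.2 ⟨χ, ⟨hd, h⟩, hasChain_two_of_listed hn hχ⟩)
  · rintro ⟨χ, hχ, hμχ⟩
    refine levelIs.of_mem_orbit ⟨hasChain_two_of_listed hn hχ, fun h3 => ?_⟩ hμχ
    obtain ⟨ψ, hψ, h2⟩ := hasChain_succ.1 h3
    obtain ⟨θ, hθ, hd⟩ := (not_hasChain_two_or_listed (hψ.1.isAlt hχ.isAlt)).resolve_left
      (not_not.2 h2)
    have h1 := hχ.mem_orbit_of_degenerates hn hθ (hψ.1.trans hd)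
    exact hψ.2 (mem_orbit_of_degenerates_of_degenerates hψ.1
      (hd.trans (degenerates_of_mem_orbit (mem_orbit_symm h1))))

theorem jacobi_of_mem_orbit_listed {n : ℕ} (hn : 3 ≤ n) {μ χ : AlgStr k n} (h : IsListed n χ)
    (hμ : μ ∈ orbit χ) (x y z : Fin n → k) :
    μ (μ x y) z + μ (μ y z) x + μ (μ z x) y = 0 := by
  rcases h with ⟨α, β, -, rfl⟩ | ⟨-, rfl⟩ | ⟨-, rfl | rfl⟩
  · obtain ⟨f, g, w, hf, hg, h⟩ := T02_form hn hμ
    simp only [h]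
    simp only [map_add, map_sub, map_smul, smul_eq_mul, hf, hg]
    module
  · obtain ⟨f, M, hf, -, h⟩ := T03_form hμ
    simp only [h]
    simp only [map_sub, map_smul, smul_eq_mul, hf]
    module
  · simp [T022_nilpotent μ hμ]
  · simp [eta_nilpotent μ hμ]

/-! ## STATEMENT 13 -/
theorem stmt13 {k : Type*} [Field k] [IsAlgClosed k] (n : ℕ) (μ : AlgStr k n)
    (hac : ∀ a : Fin n → k, μ a a = 0) :
    (n = 2 → ¬ hasChain μ 2) ∧
    (n = 3 → (levelIs μ 2 ↔
      ∃ α β : k, (α, β) ≠ (0, 0) ∧ μ ∈ orbit (T02str n α β))) ∧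
    (n = 4 → (levelIs μ 2 ↔
      ((∃ α β : k, (α, β) ≠ (0, 0) ∧ μ ∈ orbit (T02str n α β)) ∨
        μ ∈ orbit (T03str n)))) ∧
    (5 ≤ n → (levelIs μ 2 ↔
      ((∃ α β : k, (α, β) ≠ (0, 0) ∧ μ ∈ orbit (T02str n α β)) ∨
        μ ∈ orbit (T022str n) ∨ μ ∈ orbit (etaStr n 2)))) ∧
    (levelIs μ 2 →
      ∀ x y z : Fin n → k, μ (μ x y) z + μ (μ y z) x + μ (μ z x) y = 0) := by
  refine ⟨fun hn => not_hasChain_two_of_le_two hn.le hac, fun hn => ?_, fun hn => ?_, fun hn => ?_,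
    fun h => ?_⟩
  · rw [levelIs_two_iff (by omega) hac]
    constructor
    · rintro ⟨χ, ⟨α, β, hαβ, rfl⟩ | ⟨h4, -⟩ | ⟨h5, -⟩, hμ⟩
      · exact ⟨α, β, hαβ, hμ⟩
      · omega
      · omega
    · rintro ⟨α, β, hαβ, hμ⟩
      exact ⟨_, Or.inl ⟨α, β, hαβ, rfl⟩, hμ⟩
  · rw [levelIs_two_iff (by omega) hac]
    constructor
    · rintro ⟨χ, ⟨α, β, hαβ, rfl⟩ | ⟨-, rfl⟩ | ⟨h5, -⟩, hμ⟩
      · exact Or.inl ⟨α, β, hαβ, hμ⟩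
      · exact Or.inr hμ
      · omega
    · rintro (⟨α, β, hαβ, hμ⟩ | hμ)
      · exact ⟨_, Or.inl ⟨α, β, hαβ, rfl⟩, hμ⟩
      · exact ⟨_, Or.inr (Or.inl ⟨hn, rfl⟩), hμ⟩
  · rw [levelIs_two_iff (by omega) hac]
    constructor
    · rintro ⟨χ, ⟨α, β, hαβ, rfl⟩ | ⟨h4, -⟩ | ⟨-, rfl | rfl⟩, hμ⟩
      · exact Or.inl ⟨α, β, hαβ, hμ⟩
      · omega
      · exact Or.inr (Or.inl hμ)
      · exact Or.inr (Or.inr hμ)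
    · rintro (⟨α, β, hαβ, hμ⟩ | hμ | hμ)
      · exact ⟨_, Or.inl ⟨α, β, hαβ, rfl⟩, hμ⟩
      · exact ⟨_, Or.inr (Or.inr ⟨hn, Or.inl rfl⟩), hμ⟩
      · exact ⟨_, Or.inr (Or.inr ⟨hn, Or.inr rfl⟩), hμ⟩
  · rcases Nat.lt_or_ge 2 n with hn | hn
    · obtain ⟨χ, hχ, hμ⟩ := (levelIs_two_iff hn hac).1 h
      exact jacobi_of_mem_orbit_listed hn hχ hμ
    · exact absurd h.1 (not_hasChain_two_of_le_two hn hac)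

end
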